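/- arXiv:1711.01367 — 11 statements merged into one kernel-verified Lean document; each statement's English description precedes it below -/
import Mathlib

section
/- Let (x*, y*, λ*) be a saddle-point datum with optimal value F*. Then for every ρ > 0 and every z = (x, y) ∈ H1 × H2, one has −‖λ*‖ · dist_K(A x + B y − c) ≤ F(x,y) − F* and F(x,y) − F* ≤ S_ρ(x,y) − (ρ/2) dist_K(A x + B y − c)². -/
open scoped RealInnerProductSpace

/-- Lemma 1, first part: for a saddle-point datum `(x⋆, y⋆, λ⋆)` with
optimal value `F⋆ = f x⋆ + g y⋆`, every `ρ > 0` and every `(x, y)` satisfy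
`−‖λ⋆‖ · dist_K(A x + B y − c) ≤ F(x,y) − F⋆` and
`F(x,y) − F⋆ ≤ S_ρ(x,y) − (ρ/2) dist_K(A x + B y − c)²`, where
`S_ρ(x,y) = f x + g y + ρ · (1/2) dist_K(A x + B y − c)² − F⋆`. -/
theorem stmt_0
    {H1 H2 H : Type*}
    [NormedAddCommGroup H1] [InnerProductSpace ℝ H1]
    [NormedAddCommGroup H2] [InnerProductSpace ℝ H2]
    [NormedAddCommGroup H] [InnerProductSpace ℝ H]
    (A : H1 →L[ℝ] H) (B : H2 →L[ℝ] H) (c : H) (K : Set H)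
    (hKne : K.Nonempty) (hKcl : IsClosed K) (hKcv : Convex ℝ K)
    (f : H1 → ℝ) (g : H2 → ℝ)
    (hf : ConvexOn ℝ Set.univ f) (hg : ConvexOn ℝ Set.univ g)
    (xs : H1) (ys : H2) (lams : H)
    (hfeas : A xs + B ys - c ∈ K)
    (hsaddle : ∀ (x : H1) (y : H2), ∀ r ∈ K,
      f x + g y - ⟪lams, A x + B y - r - c⟫ ≥ f xs + g ys) :
    ∀ ρ : ℝ, 0 < ρ → ∀ (x : H1) (y : H2),
      (-‖lams‖ * Metric.infDist (A x + B y - c) K ≤ (f x + g y) - (f xs + g ys)) ∧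
      ((f x + g y) - (f xs + g ys) ≤
        ((f x + g y + ρ * ((1/2) * Metric.infDist (A x + B y - c) K ^ 2))
            - (f xs + g ys))
          - (ρ/2) * Metric.infDist (A x + B y - c) K ^ 2) := by
  intro ρ _ x y
  refine ⟨?_, by linarith⟩
  have hdist : ∀ r ∈ K, -((f x + g y) - (f xs + g ys)) ≤ ‖lams‖ * dist (A x + B y - c) r := by
    intro r hr
    have hr' := hsaddle x y r hr
    rw [sub_right_comm] at hr'
    have hcs := neg_le_of_abs_le (abs_real_inner_le_norm lams (A x + B y - c - r))
    rw [dist_eq_norm]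
    linarith
  rcases (norm_nonneg lams).eq_or_lt with h0 | hpos
  · obtain ⟨r, hr⟩ := hKne
    have := hdist r hr
    rw [← h0] at this ⊢
    linarith
  · have := (Metric.le_infDist hKne).2 fun r hr => (div_le_iff₀' hpos).2 (hdist r hr)
    rw [div_le_iff₀' hpos] at this
    linarith
end

section
/- Let (x*, y*, λ*) be a saddle-point datum with optimal value F*. Then for every ρ > 0 and every z = (x, y) ∈ H1 × H2: (i) ‖λ*‖² + 2ρ S_ρ(x,y) ≥ (ρ²/2) ‖A x + B y − c − P_K(A x + B y − c) + (1/ρ) λ*‖² ≥ 0, and (ii) dist_K(A x + B y − c) ≤ (1/ρ) [ ‖λ*‖ + √(‖λ*‖² + 2ρ S_ρ(x,y)) ]. -/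
open scoped RealInnerProductSpace

/-- A point `p ∈ K` satisfying the variational inequality of the projection of `u` onto `K`
realizes the distance from `u` to `K`. -/
theorem Metric.infDist_eq_norm_sub_of_inner_nonpos {E : Type*} [NormedAddCommGroup E]
    [InnerProductSpace ℝ E] {K : Set E} {u p : E} (hp : p ∈ K)
    (h : ∀ w ∈ K, ⟪u - p, w - p⟫ ≤ 0) : Metric.infDist u K = ‖u - p‖ := by
  refine le_antisymm ((Metric.infDist_le_dist_of_mem hp).trans_eq (dist_eq_norm u p))
    ((Metric.le_infDist ⟨p, hp⟩).2 fun w hw => ?_)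
  have hsq : ‖u - w‖ ^ 2 = ‖u - p‖ ^ 2 - 2 * ⟪u - p, w - p⟫ + ‖w - p‖ ^ 2 := by
    rw [← norm_sub_sq_real, sub_sub_sub_cancel_right]
  rw [dist_eq_norm]
  refine abs_le_of_sq_le_sq' ?_ (norm_nonneg _) |>.2
  nlinarith [h w hw, sq_nonneg ‖w - p‖]

/-- Lemma 1, second part: for a saddle-point datum `(x⋆, y⋆, λ⋆)`,
every `ρ > 0` and `(x, y)` satisfy
`‖λ⋆‖² + 2ρ S_ρ(x,y) ≥ (ρ²/2) ‖A x + B y − c − P_K(A x + B y − c) + (1/ρ) λ⋆‖² ≥ 0`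
and `dist_K(A x + B y − c) ≤ (1/ρ)[‖λ⋆‖ + √(‖λ⋆‖² + 2ρ S_ρ(x,y))]`. -/
theorem stmt_1
    {H1 H2 H : Type*}
    [NormedAddCommGroup H1] [InnerProductSpace ℝ H1]
    [NormedAddCommGroup H2] [InnerProductSpace ℝ H2]
    [NormedAddCommGroup H] [InnerProductSpace ℝ H]
    (A : H1 →L[ℝ] H) (B : H2 →L[ℝ] H) (c : H) (K : Set H)
    (hKne : K.Nonempty) (hKcl : IsClosed K) (hKcv : Convex ℝ K)
    (P : H → H) (hPmem : ∀ u, P u ∈ K)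
    (hPproj : ∀ u, ∀ w ∈ K, ⟪u - P u, w - P u⟫ ≤ 0)
    (f : H1 → ℝ) (g : H2 → ℝ)
    (hf : ConvexOn ℝ Set.univ f) (hg : ConvexOn ℝ Set.univ g)
    (xs : H1) (ys : H2) (lams : H)
    (hfeas : A xs + B ys - c ∈ K)
    (hsaddle : ∀ (x : H1) (y : H2), ∀ r ∈ K,
      f x + g y - ⟪lams, A x + B y - r - c⟫ ≥ f xs + g ys) :
    ∀ ρ : ℝ, 0 < ρ → ∀ (x : H1) (y : H2),
      (‖lams‖ ^ 2 + 2 * ρ *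
          ((f x + g y + ρ * ((1/2) * Metric.infDist (A x + B y - c) K ^ 2))
            - (f xs + g ys)) ≥
        (ρ ^ 2 / 2) * ‖(A x + B y - c) - P (A x + B y - c) + (1/ρ) • lams‖ ^ 2) ∧
      ((ρ ^ 2 / 2) * ‖(A x + B y - c) - P (A x + B y - c) + (1/ρ) • lams‖ ^ 2 ≥ 0) ∧
      (Metric.infDist (A x + B y - c) K ≤
        (1/ρ) * (‖lams‖ + Real.sqrt (‖lams‖ ^ 2 + 2 * ρ *
          ((f x + g y + ρ * ((1/2) * Metric.infDist (A x + B y - c) K ^ 2))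
            - (f xs + g ys))))) := by
  intro ρ hρ x y
  have hdist : Metric.infDist (A x + B y - c) K = ‖(A x + B y - c) - P (A x + B y - c)‖ :=
    Metric.infDist_eq_norm_sub_of_inner_nonpos (hPmem _) (hPproj _)
  have hlag := hsaddle x y _ (hPmem (A x + B y - c))
  rw [sub_right_comm] at hlag
  rw [hdist]
  set d := (A x + B y - c) - P (A x + B y - c)
  set S := f x + g y + ρ * ((1/2) * ‖d‖ ^ 2) - (f xs + g ys) with hS
  have hscale : ρ • (d + (1/ρ) • lams) = ρ • d + lams := by
    rw [smul_add, smul_smul, mul_one_div_cancel hρ.ne', one_smul]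
  have hnorm : ρ * ‖d + (1/ρ) • lams‖ = ‖ρ • d + lams‖ := by
    rw [← hscale, norm_smul, Real.norm_of_nonneg hρ.le]
  have hkey : ‖ρ • d + lams‖ ^ 2 ≤ ‖lams‖ ^ 2 + 2 * ρ * S := by
    rw [norm_add_sq_real, norm_smul, Real.norm_of_nonneg hρ.le, real_inner_smul_left,
      real_inner_comm]
    nlinarith [mul_le_mul_of_nonneg_left hlag hρ.le]
  refine ⟨?_, by positivity, ?_⟩
  · rw [← hnorm, mul_pow] at hkey
    nlinarith [sq_nonneg (ρ * ‖d + (1/ρ) • lams‖)]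
  · rw [one_div_mul_eq_div, le_div_iff₀' hρ]
    calc ρ * ‖d‖ = ‖ρ • d‖ := by rw [norm_smul, Real.norm_of_nonneg hρ.le]
      _ ≤ ‖lams‖ + ‖ρ • d + lams‖ := by
        simpa [add_comm] using norm_sub_le (ρ • d + lams) lams
      _ ≤ _ := by gcongr; exact Real.le_sqrt_of_sq_le hkey
end

section
/- Let H be a real Hilbert space, K ⊆ H a nonempty closed convex set, u ∈ H, and v ∈ K a point satisfying ⟨u − v, w − v⟩ ≤ 0 for all w ∈ K (i.e., v is the nearest point of u in K). Then the function φ : H → ℝ defined by φ(u') := (1/2) dist_K(u')² is Fréchet differentiable at u with derivative the continuous linear functional w ↦ ⟨u − v, w⟩; in other words, the gradient of φ at u equals u − v = u − P_K(u). -/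
open scoped RealInnerProductSpace

/-- If `v ∈ K` satisfies the variational inequality for `u`, the squared distance to `K` lies above
its linearization at `u`. -/
theorem le_infDist_add_sq_of_inner_nonpos
    {H : Type*} [NormedAddCommGroup H] [InnerProductSpace ℝ H] {K : Set H} {u v : H}
    (hv : v ∈ K) (hproj : ∀ w ∈ K, ⟪u - v, w - v⟫ ≤ 0) (h : H) :
    ‖u - v‖ ^ 2 + 2 * ⟪u - v, h⟫ ≤ Metric.infDist (u + h) K ^ 2 := by
  refine (Real.sqrt_le_iff.1 ((Metric.le_infDist ⟨v, hv⟩).2 fun w hw => ?_)).2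
  refine Real.sqrt_le_iff.2 ⟨dist_nonneg, ?_⟩
  have key : u + h - w = (u - v) + (h - (w - v)) := by abel
  rw [dist_eq_norm, key, norm_add_sq_real, inner_sub_right]
  nlinarith [hproj w hw, sq_nonneg ‖h - (w - v)‖]

/-- The squared distance to `K` is bounded by the squared distance to a point `v ∈ K`. -/
theorem infDist_add_sq_le
    {H : Type*} [NormedAddCommGroup H] [InnerProductSpace ℝ H] {K : Set H} {v : H}
    (hv : v ∈ K) (u h : H) :
    Metric.infDist (u + h) K ^ 2 ≤ ‖u - v‖ ^ 2 + 2 * ⟪u - v, h⟫ + ‖h‖ ^ 2 := by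
  rw [← norm_add_sq_real, sub_add_eq_add_sub, ← dist_eq_norm]
  exact pow_le_pow_left₀ Metric.infDist_nonneg (Metric.infDist_le_dist_of_mem hv) 2

/-- If `v ∈ K` is the nearest point of `u` in the nonempty closed convex
set `K` (characterized by the variational inequality), then `φ(u') := (1/2) dist_K(u')²`
is Fréchet differentiable at `u` with derivative `w ↦ ⟪u − v, w⟫`, i.e. with gradient
`u − v = u − P_K(u)`. -/
theorem stmt_2
    {H : Type*} [NormedAddCommGroup H] [InnerProductSpace ℝ H]
    (K : Set H) (hKne : K.Nonempty) (hKcl : IsClosed K) (hKcv : Convex ℝ K)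
    (u v : H) (hv : v ∈ K) (hproj : ∀ w ∈ K, ⟪u - v, w - v⟫ ≤ 0) :
    HasFDerivAt (fun u' : H => (1/2) * Metric.infDist u' K ^ 2)
      (innerSL ℝ (u - v)) u := by
  have hu : Metric.infDist u K ^ 2 = ‖u - v‖ ^ 2 := by
    have h₁ := le_infDist_add_sq_of_inner_nonpos hv hproj 0
    have h₂ := infDist_add_sq_le hv u 0
    simp only [add_zero, inner_zero_right, mul_zero, norm_zero] at h₁ h₂
    linarith
  rw [hasFDerivAt_iff_isLittleO_nhds_zero]
  refine Asymptotics.IsBigO.trans_isLittleO (g := fun h : H => ‖h‖ ^ 2) ?_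
    (Asymptotics.isLittleO_norm_pow_id one_lt_two)
  refine Asymptotics.IsBigO.of_bound 1 (Filter.Eventually.of_forall fun h => ?_)
  have h₁ := le_infDist_add_sq_of_inner_nonpos hv hproj h
  have h₂ := infDist_add_sq_le hv u h
  rw [Real.norm_eq_abs, Real.norm_of_nonneg (sq_nonneg ‖h‖), innerSL_apply_apply, hu, abs_le]
  constructor <;> linarith [sq_nonneg ‖h‖]
end

section
/- Fix ρ > 0 and γ ≥ 0, points x̂, x⁺ ∈ H1 and ŷ, y⁺ ∈ H2, and set û := A x⁺ + B ŷ − c and ŝ := û − P_K(û). Suppose there exists a subgradient ξ of f at x⁺ with ξ + ρ A* ŝ + γ (x⁺ − x̂) = 0, and a subgradient η of g at y⁺ with η + ρ B* ŝ + ρ ‖B‖² (y⁺ − ŷ) = 0. Then for every (x, y) ∈ H1 × H2: Φ_ρ(x⁺, y⁺) ≤ F(x,y) + ρ ℓ(x,y) + γ ⟨x⁺ − x̂, x − x̂⟩ − γ ‖x⁺ − x̂‖² + ρ ‖B‖² ⟨y⁺ − ŷ, y − ŷ⟩ − (ρ ‖B‖²/2) ‖y⁺ − ŷ‖², where ℓ(x,y)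 := (1/2)‖ŝ‖² + ⟨ŝ, A(x − x⁺) + B(y − ŷ)⟩. -/
open scoped RealInnerProductSpace

/-- Expanding the square of the distance to a set around a point `p` of the set. -/
theorem sq_infDist_add_le {H : Type*} [NormedAddCommGroup H] [InnerProductSpace ℝ H]
    {K : Set H} {p : H} (hp : p ∈ K) (u v : H) :
    Metric.infDist (u + v) K ^ 2 ≤ ‖u - p‖ ^ 2 + 2 * ⟪u - p, v⟫ + ‖v‖ ^ 2 := by
  rw [← norm_add_sq_real, show u - p + v = u + v - p by abel, ← dist_eq_norm]
  exact pow_le_pow_left₀ Metric.infDist_nonneg (Metric.infDist_le_dist_of_mem hp) 2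

/-- A stationarity relation `ξ + ρ T* s + τ d = 0`, tested against a vector `v`. -/
theorem inner_eq_of_add_adjoint_add_eq_zero {E H : Type*}
    [NormedAddCommGroup E] [InnerProductSpace ℝ E] [CompleteSpace E]
    [NormedAddCommGroup H] [InnerProductSpace ℝ H] [CompleteSpace H]
    {T : E →L[ℝ] H} {ρ τ : ℝ} {ξ d : E} {s : H}
    (h : ξ + ρ • ContinuousLinearMap.adjoint T s + τ • d = 0) (v : E) :
    ⟪ξ, v⟫ = -(ρ * ⟪s, T v⟫) - τ * ⟪d, v⟫ := by
  have h' := congrArg (fun z => ⟪z, v⟫) h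
  simp only [inner_add_left, real_inner_smul_left, ContinuousLinearMap.adjoint_inner_left,
    inner_zero_left] at h'
  linarith

/-- (Lemma 3(a), key descent property of the alternating step of
Algorithm 1.) With `û := A x⁺ + B ŷ − c`, `ŝ := û − P_K(û)`, optimality conditions
`ξ + ρ A* ŝ + γ (x⁺ − x̂) = 0` (`ξ` a subgradient of `f` at `x⁺`) and
`η + ρ B* ŝ + ρ‖B‖² (y⁺ − ŷ) = 0` (`η` a subgradient of `g` at `y⁺`), one has for all
`(x,y)`:
`Φ_ρ(x⁺,y⁺) ≤ F(x,y) + ρ ℓ(x,y) + γ⟪x⁺ − x̂, x − x̂⟫ − γ‖x⁺ − x̂‖²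
  + ρ‖B‖²⟪y⁺ − ŷ, y − ŷ⟫ − (ρ‖B‖²/2)‖y⁺ − ŷ‖²`,
where `ℓ(x,y) := (1/2)‖ŝ‖² + ⟪ŝ, A(x − x⁺) + B(y − ŷ)⟫`. -/
theorem stmt_8
    {H1 H2 H : Type*}
    [NormedAddCommGroup H1] [InnerProductSpace ℝ H1] [CompleteSpace H1]
    [NormedAddCommGroup H2] [InnerProductSpace ℝ H2] [CompleteSpace H2]
    [NormedAddCommGroup H] [InnerProductSpace ℝ H] [CompleteSpace H]
    (A : H1 →L[ℝ] H) (B : H2 →L[ℝ] H) (c : H) (K : Set H)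
    (hKne : K.Nonempty) (hKcl : IsClosed K) (hKcv : Convex ℝ K)
    (f : H1 → ℝ) (g : H2 → ℝ)
    (hf : ConvexOn ℝ Set.univ f) (hg : ConvexOn ℝ Set.univ g)
    (ρ γ : ℝ) (hρ : 0 < ρ) (hγ : 0 ≤ γ)
    (xh xp : H1) (yh yp : H2) (p : H)
    (hp : p ∈ K) (hpproj : ∀ w ∈ K, ⟪(A xp + B yh - c) - p, w - p⟫ ≤ 0)
    (ξ : H1) (hξ : ∀ x : H1, f x ≥ f xp + ⟪ξ, x - xp⟫)
    (hξ0 : ξ + ρ • (ContinuousLinearMap.adjoint A ((A xp + B yh - c) - p))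
        + γ • (xp - xh) = 0)
    (η : H2) (hη : ∀ y : H2, g y ≥ g yp + ⟪η, y - yp⟫)
    (hη0 : η + ρ • (ContinuousLinearMap.adjoint B ((A xp + B yh - c) - p))
        + (ρ * ‖B‖ ^ 2) • (yp - yh) = 0) :
    ∀ (x : H1) (y : H2),
      f xp + g yp + ρ * ((1/2) * Metric.infDist (A xp + B yp - c) K ^ 2) ≤
        f x + g y
          + ρ * ((1/2) * ‖(A xp + B yh - c) - p‖ ^ 2
              + ⟪(A xp + B yh - c) - p, A (x - xp) + B (y - yh)⟫)
          + γ * ⟪xp - xh, x - xh⟫ - γ * ‖xp - xh‖ ^ 2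
          + ρ * ‖B‖ ^ 2 * ⟪yp - yh, y - yh⟫
          - (ρ * ‖B‖ ^ 2 / 2) * ‖yp - yh‖ ^ 2 := by
  intro x y
  have hfx := hξ x
  rw [inner_eq_of_add_adjoint_add_eq_zero hξ0] at hfx
  have hgy := hη y
  rw [inner_eq_of_add_adjoint_add_eq_zero hη0] at hgy
  have hdist := sq_infDist_add_le hp (A xp + B yh - c) (B (yp - yh))
  rw [show A xp + B yh - c + B (yp - yh) = A xp + B yp - c by rw [map_sub]; abel] at hdist
  have hB : ‖B (yp - yh)‖ ^ 2 ≤ ‖B‖ ^ 2 * ‖yp - yh‖ ^ 2 := by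
    rw [← mul_pow]
    exact pow_le_pow_left₀ (norm_nonneg _) (B.le_opNorm _) 2
  have hψ := mul_le_mul_of_nonneg_left (hdist.trans (add_le_add_right hB _)) hρ.le
  have hx : ⟪xp - xh, x - xh⟫ = ⟪xp - xh, x - xp⟫ + ‖xp - xh‖ ^ 2 := by
    rw [← real_inner_self_eq_norm_sq, ← inner_add_right, sub_add_sub_cancel]
  have hy : ⟪yp - yh, y - yh⟫ = ⟪yp - yh, y - yp⟫ + ‖yp - yh‖ ^ 2 := by
    rw [← real_inner_self_eq_norm_sq, ← inner_add_right, sub_add_sub_cancel]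
  have hs : B (y - yh) = B (y - yp) + B (yp - yh) := by
    rw [← map_add, sub_add_sub_cancel]
  rw [hx, hy, hs, inner_add_right, inner_add_right]
  linarith
end

section
/- Fix ρ > 0, γ₀ ≥ 0, τ ∈ (0,1], and μ_g ≥ 0. Let x^k, x̃^k, x̃^{k+1}, x̂^k, x^{k+1} ∈ H1 and y^k, ỹ^k, ỹ^{k+1}, ŷ^k ∈ H2 satisfy x̂^k = (1−τ) x^k + τ x̃^k, x̃^{k+1} = x̃^k + (1/τ)(x^{k+1} − x̂^k), and ŷ^k = (1−τ) y^k + τ ỹ^k. Set û := A x^{k+1} + B ŷ^k − c and ŝ := û − P_K(û). Suppose there exists a subgradient ξ of f at x^{k+1} with ξ + ρ A* ŝ + γ₀ (x^{k+1} − x̂^k) = 0, and a vector η with η + ρ B* ŝ + τ ρ ‖B‖² (ỹ^{k+1} − ỹ^k) = 0 and g(y) ≥ g(ỹ^{k+1}) + ⟨η, y − ỹ^{k+1}⟩ + (μ_g/2)‖y − ỹ^{k+1}‖² for all y ∈ H2. Let y̆^{k+1} := (1−τ) y^k + τ ỹ^{k+1}. Then for every (x,y) ∈ H1 × H2: f(x^{k+1})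 + g(y̆^{k+1}) + ρ Q(y̆^{k+1}) ≤ (1−τ)[F(x^k,y^k) + ρ ℓ(x^k,y^k)] + τ [F(x,y) + ρ ℓ(x,y)] + (γ₀ τ²/2)‖x̃^k − x‖² − (γ₀ τ²/2)‖x̃^{k+1} − x‖² + (ρ τ² ‖B‖²/2)‖ỹ^k − y‖² − ((ρ τ² ‖B‖² + μ_g τ)/2)‖ỹ^{k+1} − y‖², where ℓ(x,y) := (1/2)‖ŝ‖² + ⟨ŝ, A(x − x^{k+1}) + B(y − ŷ^k)⟩ and Q(y) := (1/2)‖ŝ‖² + ⟨B* ŝ, y − ŷ^k⟩ + (‖B‖²/2)‖y − ŷ^k‖². -/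
open scoped RealInnerProductSpace

/-- Three-point identity: `2⟪a - b, c - a⟫ = ‖c - b‖² - ‖a - b‖² - ‖c - a‖²`. -/
theorem two_mul_inner_sub_sub {E : Type*} [NormedAddCommGroup E] [InnerProductSpace ℝ E]
    (a b c : E) :
    2 * ⟪a - b, c - a⟫ = ‖b - c‖ ^ 2 - ‖a - b‖ ^ 2 - ‖a - c‖ ^ 2 := by
  simp only [← real_inner_self_eq_norm_sq, inner_sub_left, inner_sub_right]
  rw [real_inner_comm b a, real_inner_comm c a, real_inner_comm c b]
  ring

/-- (Lemma 3(b), key descent property of the alternating step of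
Algorithm 2.) Under the interpolation relations for `x̂ᵏ, x̃ᵏ⁺¹, ŷᵏ`, the optimality
conditions for the `x`- and `ỹ`-updates (the latter with `μ_g`-strong subgradient
inequality for `g`), and with `y̆ᵏ⁺¹ := (1−τ)yᵏ + τ ỹᵏ⁺¹`, for every `(x,y)`:
`f(xᵏ⁺¹) + g(y̆ᵏ⁺¹) + ρ Q(y̆ᵏ⁺¹)
  ≤ (1−τ)[F(zᵏ) + ρ ℓ(zᵏ)] + τ[F(z) + ρ ℓ(z)]
    + (γ₀τ²/2)‖x̃ᵏ − x‖² − (γ₀τ²/2)‖x̃ᵏ⁺¹ − x‖²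
    + (ρτ²‖B‖²/2)‖ỹᵏ − y‖² − ((ρτ²‖B‖² + μ_g τ)/2)‖ỹᵏ⁺¹ − y‖²`. -/
theorem stmt_9
    {H1 H2 H : Type*}
    [NormedAddCommGroup H1] [InnerProductSpace ℝ H1] [CompleteSpace H1]
    [NormedAddCommGroup H2] [InnerProductSpace ℝ H2] [CompleteSpace H2]
    [NormedAddCommGroup H] [InnerProductSpace ℝ H] [CompleteSpace H]
    (A : H1 →L[ℝ] H) (B : H2 →L[ℝ] H) (c : H) (K : Set H)
    (hKne : K.Nonempty) (hKcl : IsClosed K) (hKcv : Convex ℝ K)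
    (f : H1 → ℝ) (g : H2 → ℝ)
    (hf : ConvexOn ℝ Set.univ f) (hg : ConvexOn ℝ Set.univ g)
    (ρ γ0 τ μ : ℝ) (hρ : 0 < ρ) (hγ0 : 0 ≤ γ0) (hτ0 : 0 < τ) (hτ1 : τ ≤ 1)
    (hμ : 0 ≤ μ)
    (xk xtk xtk1 xhk xk1 : H1) (yk ytk ytk1 yhk : H2) (p : H)
    (hxh : xhk = (1 - τ) • xk + τ • xtk)
    (hxt1 : xtk1 = xtk + (1/τ) • (xk1 - xhk))
    (hyh : yhk = (1 - τ) • yk + τ • ytk)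
    (hp : p ∈ K) (hpproj : ∀ w ∈ K, ⟪(A xk1 + B yhk - c) - p, w - p⟫ ≤ 0)
    (ξ : H1) (hξ : ∀ x : H1, f x ≥ f xk1 + ⟪ξ, x - xk1⟫)
    (hξ0 : ξ + ρ • (ContinuousLinearMap.adjoint A ((A xk1 + B yhk - c) - p))
        + γ0 • (xk1 - xhk) = 0)
    (η : H2)
    (hη0 : η + ρ • (ContinuousLinearMap.adjoint B ((A xk1 + B yhk - c) - p))
        + (τ * ρ * ‖B‖ ^ 2) • (ytk1 - ytk) = 0)
    (hη : ∀ y : H2, g y ≥ g ytk1 + ⟪η, y - ytk1⟫ + (μ/2) * ‖y - ytk1‖ ^ 2) :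
    ∀ (x : H1) (y : H2),
      f xk1 + g ((1 - τ) • yk + τ • ytk1)
          + ρ * ((1/2) * ‖(A xk1 + B yhk - c) - p‖ ^ 2
              + ⟪ContinuousLinearMap.adjoint B ((A xk1 + B yhk - c) - p),
                  ((1 - τ) • yk + τ • ytk1) - yhk⟫
              + (‖B‖ ^ 2 / 2) * ‖((1 - τ) • yk + τ • ytk1) - yhk‖ ^ 2) ≤
        (1 - τ) * ((f xk + g yk)
            + ρ * ((1/2) * ‖(A xk1 + B yhk - c) - p‖ ^ 2
                + ⟪(A xk1 + B yhk - c) - p, A (xk - xk1) + B (yk - yhk)⟫))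
          + τ * ((f x + g y)
            + ρ * ((1/2) * ‖(A xk1 + B yhk - c) - p‖ ^ 2
                + ⟪(A xk1 + B yhk - c) - p, A (x - xk1) + B (y - yhk)⟫))
          + (γ0 * τ ^ 2 / 2) * ‖xtk - x‖ ^ 2
          - (γ0 * τ ^ 2 / 2) * ‖xtk1 - x‖ ^ 2
          + (ρ * τ ^ 2 * ‖B‖ ^ 2 / 2) * ‖ytk - y‖ ^ 2
          - ((ρ * τ ^ 2 * ‖B‖ ^ 2 + μ * τ) / 2) * ‖ytk1 - y‖ ^ 2 := by
  intro x y
  have hxk1 : xk1 = (1 - τ) • xk + τ • xtk1 := by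
    rw [hxt1, hxh]
    match_scalars <;> field_simp <;> ring
  have hdx : xk1 - xhk = τ • (xtk1 - xtk) := by
    rw [hxk1, hxh]; module
  have hdy : ((1 - τ) • yk + τ • ytk1) - yhk = τ • (ytk1 - ytk) := by
    rw [hyh]; module
  rw [hdx] at hξ0
  rw [hdy]
  clear hpproj
  generalize (A xk1 + B yhk - c) - p = s at *
  simp only [inner_add_right, ← ContinuousLinearMap.adjoint_inner_left]
  generalize ContinuousLinearMap.adjoint A s = a at *
  generalize ContinuousLinearMap.adjoint B s = b at *
  have hξ' : ξ = -(ρ • a) - (γ0 * τ) • (xtk1 - xtk) := by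
    linear_combination (norm := module) hξ0
  have hη' : η = -(ρ • b) - (τ * ρ * ‖B‖ ^ 2) • (ytk1 - ytk) := by
    linear_combination (norm := module) hη0
  have hfx : f xk1 + τ * ⟪ξ, x - xtk1⟫ ≤ (1 - τ) * f xk + τ * f x := by
    have h1 := mul_le_mul_of_nonneg_left (hξ xk) (sub_nonneg.2 hτ1)
    have h2 := mul_le_mul_of_nonneg_left (hξ x) hτ0.le
    have h3 : (1 - τ) * ⟪ξ, xk - xk1⟫ + τ * ⟪ξ, x - xk1⟫ = τ * ⟪ξ, x - xtk1⟫ := by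
      rw [← real_inner_smul_right, ← real_inner_smul_right, ← real_inner_smul_right,
        ← inner_add_right, hxk1]
      congr 1
      module
    linarith
  have hgy : g ((1 - τ) • yk + τ • ytk1) ≤ (1 - τ) * g yk + τ * g ytk1 := by
    simpa using hg.2 (Set.mem_univ yk) (Set.mem_univ ytk1) (sub_nonneg.2 hτ1) hτ0.le
      (sub_add_cancel 1 τ)
  have hgη := mul_le_mul_of_nonneg_left (hη y) hτ0.le
  have ha : (1 - τ) * ⟪a, xk - xk1⟫ + τ * ⟪a, x - xk1⟫ = τ * ⟪a, x - xtk1⟫ := by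
    rw [← real_inner_smul_right, ← real_inner_smul_right, ← real_inner_smul_right,
      ← inner_add_right, hxk1]
    congr 1
    module
  have hb : (1 - τ) * ⟪b, yk - yhk⟫ + τ * ⟪b, y - yhk⟫
      = τ * ⟪b, y - ytk1⟫ + τ * ⟪b, ytk1 - ytk⟫ := by
    simp only [← real_inner_smul_right, ← inner_add_right]
    rw [hyh]
    congr 1
    module
  have hξi : ⟪ξ, x - xtk1⟫ = -(ρ * ⟪a, x - xtk1⟫) - γ0 * τ * ⟪xtk1 - xtk, x - xtk1⟫ := by
    rw [hξ', inner_sub_left, inner_neg_left, real_inner_smul_left, real_inner_smul_left]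
  have hηi : ⟪η, y - ytk1⟫
      = -(ρ * ⟪b, y - ytk1⟫) - τ * ρ * ‖B‖ ^ 2 * ⟪ytk1 - ytk, y - ytk1⟫ := by
    rw [hη', inner_sub_left, inner_neg_left, real_inner_smul_left, real_inner_smul_left]
  have hn : ‖τ • (ytk1 - ytk)‖ ^ 2 = τ ^ 2 * ‖ytk1 - ytk‖ ^ 2 := by
    rw [norm_smul, mul_pow, Real.norm_eq_abs, sq_abs]
  have h3x := two_mul_inner_sub_sub xtk1 xtk x
  have h3y := two_mul_inner_sub_sub ytk1 ytk y
  have hpos : 0 ≤ γ0 * τ ^ 2 / 2 * ‖xtk1 - xtk‖ ^ 2 := by positivity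
  rw [hξi] at hfx
  rw [hηi, norm_sub_rev y ytk1] at hgη
  rw [hn, real_inner_smul_right]
  linear_combination hfx + hgy + hgη + hpos - ρ * ha - ρ * hb
    + (γ0 * τ ^ 2 / 2) * h3x + (ρ * τ ^ 2 * ‖B‖ ^ 2 / 2) * h3y
end

section
/- Let (x*, y*, λ*) be a saddle-point datum with optimal value F*. Fix k ≥ 1, τ_k := 1/(k+1), ρ_{k−1} > 0, ρ_k > 0, γ_k ≥ 0. Let (x^k, y^k), (x̃^k, ỹ^k) be given, set (x̂^k, ŷ^k) := (1−τ_k)(x^k, y^k) + τ_k (x̃^k, ỹ^k) and (x̃^{k+1}, ỹ^{k+1}) := (x̃^k, ỹ^k) + (1/τ_k)((x^{k+1}, y^{k+1}) − (x̂^k, ŷ^k)), where x^{k+1} and y^{k+1} satisfy: there is a subgradient ξ of f at x^{k+1} with ξ + ρ_k A* ŝ + γ_k (x^{k+1} − x̂^k) = 0, and a subgradient η of g at y^{k+1} with η + ρ_k B* ŝ + ρ_k ‖B‖² (y^{k+1} − ŷ^k) = 0, with ŝ := (A x^{k+1} + B ŷ^k − c) − P_K(A x^{k+1} + B ŷ^k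 − c). Then, with s^k := (A x^k + B y^k − c) − P_K(A x^k + B y^k − c): Φ_{ρ_k}(x^{k+1}, y^{k+1}) ≤ (1−τ_k) Φ_{ρ_{k−1}}(x^k, y^k) + τ_k F* + (γ_k τ_k²/2)‖x̃^k − x*‖² − (γ_k τ_k²/2)‖x̃^{k+1} − x*‖² + (ρ_k τ_k² ‖B‖²/2)‖ỹ^k − y*‖² − (ρ_k τ_k² ‖B‖²/2)‖ỹ^{k+1} − y*‖² − ((1−τ_k)/2)[ρ_{k−1} − ρ_k(1−τ_k)]‖s^k‖². -/
open scoped RealInnerProductSpace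

/-- A point satisfying the variational inequality of the projection onto `K` is at distance at most
`infDist u K` from `u`. -/
theorem norm_sub_le_infDist_of_forall_inner_nonpos {H : Type*} [NormedAddCommGroup H]
    [InnerProductSpace ℝ H] {K : Set H} (hK : K.Nonempty) {u p : H}
    (hp : ∀ w ∈ K, ⟪u - p, w - p⟫ ≤ 0) : ‖u - p‖ ≤ Metric.infDist u K := by
  refine (Metric.le_infDist hK).2 fun w hw => ?_
  rw [dist_eq_norm]
  have hexp : u - w = (u - p) - (w - p) := by abel
  have hsq : ‖u - w‖ ^ 2 = ‖u - p‖ ^ 2 - 2 * ⟪u - p, w - p⟫ + ‖w - p‖ ^ 2 := by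
    rw [hexp, norm_sub_sq_real]
  refine le_of_sq_le_sq ?_ (norm_nonneg _)
  nlinarith [hp w hw, sq_nonneg ‖w - p‖]

/-- Linearizing the half squared distance to `K` at `u` with gradient `u - p`, where `p` is the
projection of `u`, and evaluating at `q + s` with `q ∈ K`. -/
theorem inner_add_sub_le_of_forall_inner_nonpos {H : Type*} [NormedAddCommGroup H]
    [InnerProductSpace ℝ H] {K : Set H} {u p q : H} (hp : ∀ w ∈ K, ⟪u - p, w - p⟫ ≤ 0)
    (hq : q ∈ K) (s : H) : ⟪u - p, q + s - u⟫ ≤ ⟪u - p, s⟫ - ‖u - p‖ ^ 2 := by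
  have hexp : q + s - u = (q - p) + s - (u - p) := by abel
  rw [hexp, inner_sub_right, inner_add_right, real_inner_self_eq_norm_sq]
  linarith [hp q hq]

/-- Three-point estimate for an accelerated proximal step on a linearized objective. -/
theorem accelerated_prox_step_le {E : Type*} [NormedAddCommGroup E] [InnerProductSpace ℝ E]
    {h : E → ℝ} {τ μ : ℝ} (hτ0 : 0 < τ) (hτ1 : τ ≤ 1)
    {z zs zt zt' zh z' ζ v : E} (hzh : zh = (1 - τ) • z + τ • zt)
    (hzt' : zt' = zt + (1 / τ) • (z' - zh))
    (hζ : ∀ x, h x ≥ h z' + ⟪ζ, x - z'⟫) (hopt : ζ + v + μ • (z' - zh) = 0) :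
    h z' ≤ (1 - τ) * h z + τ * h zs + ⟪v, (1 - τ) • z + τ • zs - z'⟫
      + (μ * τ ^ 2 / 2) * ‖zt - zs‖ ^ 2 - (μ * τ ^ 2 / 2) * ‖zt' - zs‖ ^ 2
      - (μ / 2) * ‖z' - zh‖ ^ 2 := by
  have hstep : z' - zh = τ • (zt' - zt) := by
    rw [hzt', add_sub_cancel_left, smul_smul, mul_one_div_cancel hτ0.ne', one_smul]
  have hcomb : (1 - τ) • z + τ • zs - z' = -(τ • (zt' - zs)) := by
    rw [eq_add_of_sub_eq hstep, hzh]
    module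
  have hζv : ζ = -v - μ • (z' - zh) := by
    rw [← sub_eq_zero, ← hopt]
    abel
  have hlin : (1 - τ) * ⟪ζ, z - z'⟫ + τ * ⟪ζ, zs - z'⟫ = ⟪ζ, (1 - τ) • z + τ • zs - z'⟫ := by
    rw [← real_inner_smul_right, ← real_inner_smul_right, ← inner_add_right]
    congr 1
    module
  have hinner : ⟪ζ, (1 - τ) • z + τ • zs - z'⟫
      = -⟪v, (1 - τ) • z + τ • zs - z'⟫ + μ * τ ^ 2 * ⟪zt' - zt, zt' - zs⟫ := by
    rw [hζv, inner_sub_left, inner_neg_left, hstep, hcomb]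
    simp only [inner_neg_right, real_inner_smul_left, real_inner_smul_right]
    ring
  have hpolar : ‖zt - zs‖ ^ 2
      = ‖zt' - zs‖ ^ 2 - 2 * ⟪zt' - zt, zt' - zs⟫ + ‖zt' - zt‖ ^ 2 := by
    rw [real_inner_comm, ← norm_sub_sq_real, sub_sub_sub_cancel_left]
  have hnorm : ‖z' - zh‖ ^ 2 = τ ^ 2 * ‖zt' - zt‖ ^ 2 := by
    rw [hstep, norm_smul, mul_pow, Real.norm_eq_abs, sq_abs]
  rw [hpolar, hnorm]
  linear_combination (1 - τ) * (hζ z) + τ * (hζ zs) - hlin - hinner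

/-- (Lemma 2: key one-iteration estimate of Algorithm 1.) For a
saddle-point datum `(x⋆,y⋆,λ⋆)`, `k ≥ 1`, `τ_k = 1/(k+1)`, and one step of Algorithm 1
(interpolation identities, the optimality conditions of the two subproblems), one has
`Φ_{ρ_k}(zᵏ⁺¹) ≤ (1−τ_k)Φ_{ρ_{k−1}}(zᵏ) + τ_k F⋆
  + (γ_k τ_k²/2)(‖x̃ᵏ−x⋆‖² − ‖x̃ᵏ⁺¹−x⋆‖²) + (ρ_k τ_k²‖B‖²/2)(‖ỹᵏ−y⋆‖² − ‖ỹᵏ⁺¹−y⋆‖²)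
  − ((1−τ_k)/2)[ρ_{k−1} − ρ_k(1−τ_k)]‖sᵏ‖²`. -/
theorem stmt_10
    {H1 H2 H : Type*}
    [NormedAddCommGroup H1] [InnerProductSpace ℝ H1] [CompleteSpace H1]
    [NormedAddCommGroup H2] [InnerProductSpace ℝ H2] [CompleteSpace H2]
    [NormedAddCommGroup H] [InnerProductSpace ℝ H] [CompleteSpace H]
    (A : H1 →L[ℝ] H) (B : H2 →L[ℝ] H) (c : H) (K : Set H)
    (hKne : K.Nonempty) (hKcl : IsClosed K) (hKcv : Convex ℝ K)
    (P : H → H) (hPmem : ∀ u, P u ∈ K)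
    (hPproj : ∀ u, ∀ w ∈ K, ⟪u - P u, w - P u⟫ ≤ 0)
    (f : H1 → ℝ) (g : H2 → ℝ)
    (hf : ConvexOn ℝ Set.univ f) (hg : ConvexOn ℝ Set.univ g)
    (xs : H1) (ys : H2) (lams : H)
    (hfeas : A xs + B ys - c ∈ K)
    (hsaddle : ∀ (x : H1) (y : H2), ∀ r ∈ K,
      f x + g y - ⟪lams, A x + B y - r - c⟫ ≥ f xs + g ys)
    (k : ℕ) (hk : 1 ≤ k) (τ : ℝ) (hτ : τ = 1/((k : ℝ) + 1))
    (ρkm ρk γk : ℝ) (hρkm : 0 < ρkm) (hρk : 0 < ρk) (hγk : 0 ≤ γk)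
    (xk xtk xtk1 xhk xk1 : H1) (yk ytk ytk1 yhk yk1 : H2)
    (hxh : xhk = (1 - τ) • xk + τ • xtk)
    (hyh : yhk = (1 - τ) • yk + τ • ytk)
    (hxt1 : xtk1 = xtk + (1/τ) • (xk1 - xhk))
    (hyt1 : ytk1 = ytk + (1/τ) • (yk1 - yhk))
    (ξ : H1) (hξ : ∀ x : H1, f x ≥ f xk1 + ⟪ξ, x - xk1⟫)
    (hξ0 : ξ + ρk • (ContinuousLinearMap.adjoint A
          ((A xk1 + B yhk - c) - P (A xk1 + B yhk - c)))
        + γk • (xk1 - xhk) = 0)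
    (η : H2) (hη : ∀ y : H2, g y ≥ g yk1 + ⟪η, y - yk1⟫)
    (hη0 : η + ρk • (ContinuousLinearMap.adjoint B
          ((A xk1 + B yhk - c) - P (A xk1 + B yhk - c)))
        + (ρk * ‖B‖ ^ 2) • (yk1 - yhk) = 0) :
    f xk1 + g yk1 + ρk * ((1/2) * Metric.infDist (A xk1 + B yk1 - c) K ^ 2) ≤
      (1 - τ) * (f xk + g yk + ρkm * ((1/2) * Metric.infDist (A xk + B yk - c) K ^ 2))
        + τ * (f xs + g ys)
        + (γk * τ ^ 2 / 2) * ‖xtk - xs‖ ^ 2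
        - (γk * τ ^ 2 / 2) * ‖xtk1 - xs‖ ^ 2
        + (ρk * τ ^ 2 * ‖B‖ ^ 2 / 2) * ‖ytk - ys‖ ^ 2
        - (ρk * τ ^ 2 * ‖B‖ ^ 2 / 2) * ‖ytk1 - ys‖ ^ 2
        - ((1 - τ) / 2) * (ρkm - ρk * (1 - τ))
            * ‖(A xk + B yk - c) - P (A xk + B yk - c)‖ ^ 2 := by
  have hτ0 : 0 < τ := by
    rw [hτ]
    positivity
  have hτ1 : τ ≤ 1 := by
    rw [hτ, div_le_one (by positivity)]
    linarith [Nat.cast_nonneg (α := ℝ) k]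
  have hx := accelerated_prox_step_le (zs := xs) hτ0 hτ1 hxh hxt1 hξ hξ0
  have hy := accelerated_prox_step_le (zs := ys) hτ0 hτ1 hyh hyt1 hη hη0
  rw [real_inner_smul_left, ContinuousLinearMap.adjoint_inner_left] at hx hy
  set u := A xk1 + B yhk - c with hu
  set v := A xk + B yk - c with hv
  set d := yk1 - yhk with hd
  have hdesc : Metric.infDist (A xk1 + B yk1 - c) K ^ 2
      ≤ ‖u - P u‖ ^ 2 + 2 * ⟪u - P u, B d⟫ + ‖B‖ ^ 2 * ‖d‖ ^ 2 := by
    have hle := Metric.infDist_le_dist_of_mem (x := A xk1 + B yk1 - c) (hPmem u)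
    have hexp : A xk1 + B yk1 - c - P u = (u - P u) + B d := by
      rw [hu, hd, map_sub]
      abel
    rw [dist_eq_norm, hexp] at hle
    calc _ ≤ ‖(u - P u) + B d‖ ^ 2 := pow_le_pow_left₀ Metric.infDist_nonneg hle 2
      _ = ‖u - P u‖ ^ 2 + 2 * ⟪u - P u, B d⟫ + ‖B d‖ ^ 2 := norm_add_sq_real _ _
      _ ≤ _ := by
        rw [← mul_pow]
        gcongr
        exact B.le_opNorm d
  have hdist : ‖v - P v‖ ^ 2 ≤ Metric.infDist v K ^ 2 :=
    pow_le_pow_left₀ (norm_nonneg _)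
      (norm_sub_le_infDist_of_forall_inner_nonpos hKne (hPproj v)) 2
  have hprev := inner_add_sub_le_of_forall_inner_nonpos (hPproj u) (hPmem v) (v - P v)
  have hstar := inner_add_sub_le_of_forall_inner_nonpos (hPproj u) hfeas 0
  rw [add_sub_cancel] at hprev
  rw [inner_zero_right, add_zero] at hstar
  have hcross : ⟪u - P u, A ((1 - τ) • xk + τ • xs - xk1)⟫
      + ⟪u - P u, B ((1 - τ) • yk + τ • ys - yk1)⟫ + ⟪u - P u, B d⟫
      = (1 - τ) * ⟪u - P u, v - u⟫ + τ * ⟪u - P u, A xs + B ys - c - u⟫ := by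
    rw [← real_inner_smul_right, ← real_inner_smul_right, ← inner_add_right, ← inner_add_right,
      ← inner_add_right]
    congr 1
    simp only [hu, hv, hd, map_sub, map_add, map_smul]
    module
  have hyoung : 0 ≤ ‖u - P u‖ ^ 2 - 2 * ((1 - τ) * ⟪u - P u, v - P v⟫)
      + (1 - τ) ^ 2 * ‖v - P v‖ ^ 2 := by
    have hsq := sq_nonneg ‖(u - P u) - (1 - τ) • (v - P v)‖
    rwa [norm_sub_sq_real, real_inner_smul_right, norm_smul, mul_pow, Real.norm_eq_abs,
      sq_abs] at hsq
  have hτ1' : 0 ≤ 1 - τ := sub_nonneg.2 hτ1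
  have hγ : 0 ≤ γk / 2 * ‖xk1 - xhk‖ ^ 2 := by positivity
  linear_combination hx + hy + ρk / 2 * hdesc + (1 - τ) * ρkm / 2 * hdist
    + ρk * hcross + ρk * (1 - τ) * hprev + ρk * τ * hstar + ρk / 2 * hyoung + hγ
end

section
/- (Convergence of Algorithm 1 / PAPA.) Let (x*, y*, λ*) be a saddle-point datum with optimal value F*. Fix ρ₀ > 0 and γ₀ ≥ 0, and set ρ_k := ρ₀(k+1) and γ_k := γ₀(k+1). Let sequences (x^k), (y^k), (x̂^k), (ŷ^k) satisfy x̂⁰ = x⁰, ŷ⁰ = y⁰, and for every k ≥ 0: there is a subgradient ξ_k of f at x^{k+1} with ξ_k + ρ_k A* ŝ^{k+1} + γ_k (x^{k+1} − x̂^k) = 0; there is a subgradient η_k of g at y^{k+1} with η_k + ρ_k B* ŝ^{k+1} + ρ_k ‖B‖² (y^{k+1} − ŷ^k) = 0, where ŝ^{k+1} := (A x^{k+1} + B ŷ^k − c) − P_K(A x^{k+1} + B ŷ^k − c); and (x̂^{k+1}, ŷ^{k+1}) = (x^{k+1}, y^{k+1}) + (k/(k+2))·((x^{k+1}, y^{k+1})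 − (x^k, y^k)). Then for every k ≥ 1: |F(x^k, y^k) − F*| ≤ max{ρ₀ R_p², 2‖λ*‖ R_d} / (2 ρ₀ k) and dist_K(A x^k + B y^k − c) ≤ R_d / (ρ₀ k), where R_p² := γ₀‖x⁰ − x*‖² + ρ₀‖B‖²‖y⁰ − y*‖² and R_d := ‖λ*‖ + √(‖λ*‖² + ρ₀ R_p²). -/
open scoped RealInnerProductSpace

section Projection

variable {H : Type*} [NormedAddCommGroup H] [InnerProductSpace ℝ H] {K : Set H} {P : H → H}

/-- Half the squared distance to `K` grows at most quadratically around its linearization. -/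
lemma half_sq_norm_sub_proj_le (hPmem : ∀ u, P u ∈ K)
    (hPproj : ∀ u, ∀ w ∈ K, ⟪u - P u, w - P u⟫ ≤ 0) (u v : H) :
    ‖v - P v‖ ^ 2 / 2 ≤ ‖u - P u‖ ^ 2 / 2 + ⟪u - P u, v - u⟫ + ‖v - u‖ ^ 2 / 2 := by
  have h1 := hPproj v (P u) (hPmem u)
  have h2 := norm_sub_sq_real (v - P v) (P u - P v)
  have h3 := norm_add_sq_real (u - P u) (v - u)
  rw [show v - P v - (P u - P v) = u - P u + (v - u) by abel] at h2
  nlinarith [sq_nonneg ‖P u - P v‖]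

/-- The residual `u - P u`, paired with a displacement, is controlled by the residual at the endpoint. -/
lemma inner_sub_proj_le (hPmem : ∀ u, P u ∈ K)
    (hPproj : ∀ u, ∀ w ∈ K, ⟪u - P u, w - P u⟫ ≤ 0) (u w : H) :
    ⟪u - P u, w - u⟫ ≤ ⟪u - P u, w - P w⟫ - ‖u - P u‖ ^ 2 := by
  have h1 := hPproj u (P w) (hPmem w)
  rw [show w - u = (w - P w) - (u - P u) + (P w - P u) by abel, inner_add_right,
    inner_sub_right, real_inner_self_eq_norm_sq]
  linarith

lemma inner_sub_proj_le_of_mem (hPproj : ∀ u, ∀ w ∈ K, ⟪u - P u, w - P u⟫ ≤ 0)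
    (u : H) {w : H} (hw : w ∈ K) : ⟪u - P u, w - u⟫ ≤ -‖u - P u‖ ^ 2 := by
  have h1 := hPproj u w hw
  rw [show w - u = (w - P u) - (u - P u) by abel, inner_sub_right, real_inner_self_eq_norm_sq]
  linarith

/-- One-step estimate for the squared distance to `K` along the extrapolated iteration. -/
lemma half_sq_norm_sub_proj_step (hPmem : ∀ u, P u ∈ K)
    (hPproj : ∀ u, ∀ w ∈ K, ⟪u - P u, w - P u⟫ ≤ 0) {t : ℝ} (ht : 0 ≤ t)
    (u v v' : H) {w : H} (hw : w ∈ K) :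
    (t + 1) * ⟪u - P u, w + t • v - (t + 1) • v'⟫ + (t + 1) ^ 2 * ‖v' - P v'‖ ^ 2 / 2
      ≤ t ^ 2 * ‖v - P v‖ ^ 2 / 2 + (t + 1) ^ 2 * ‖v' - u‖ ^ 2 / 2 := by
  have h1 := half_sq_norm_sub_proj_le hPmem hPproj u v'
  have h2 := inner_sub_proj_le hPmem hPproj u v
  have h3 := inner_sub_proj_le_of_mem hPproj u hw
  have h4 := sq_nonneg ‖t • (v - P v) - (t + 1) • (u - P u)‖
  rw [norm_sub_sq_real, norm_smul, norm_smul, mul_pow, mul_pow, Real.norm_eq_abs,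
    Real.norm_eq_abs, sq_abs, sq_abs, inner_smul_left, inner_smul_right,
    real_inner_comm] at h4
  simp only [conj_trivial] at h4
  rw [show w + t • v - (t + 1) • v' = (w - u) + t • (v - u) - (t + 1) • (v' - u) by module,
    inner_sub_right, inner_add_right, inner_smul_right, inner_smul_right]
  have ht1 : 0 ≤ t + 1 := by linarith
  have h1' := mul_le_mul_of_nonneg_left h1 (sq_nonneg (t + 1))
  have h2' := mul_le_mul_of_nonneg_left h2 (mul_nonneg ht1 ht)
  have h3' := mul_le_mul_of_nonneg_left h3 ht1
  linarith

end Projection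

/-- One-step estimate for a proximal step on a function with a subgradient, compared with the
convex combination of the previous iterate and a reference point. -/
lemma proximal_step_le {E H : Type*}
    [NormedAddCommGroup E] [InnerProductSpace ℝ E] [CompleteSpace E]
    [NormedAddCommGroup H] [InnerProductSpace ℝ H] [CompleteSpace H]
    (A : E →L[ℝ] H) (f : E → ℝ) {x x' xh xs ξ : E} {s : H} {t ρ γ : ℝ} (ht : 0 ≤ t)
    (hsub : ∀ z, f z ≥ f x' + ⟪ξ, z - x'⟫)
    (hopt : ξ + (ρ * (t + 1)) • ContinuousLinearMap.adjoint A s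
      + (γ * (t + 1)) • (x' - xh) = 0) :
    (t + 1) * f x' ≤ t * f x + f xs + ρ * (t + 1) * ⟪s, A xs + t • A x - (t + 1) • A x'⟫
      + γ / 2 * (‖(t + 1) • xh - t • x - xs‖ ^ 2 - ‖(t + 1) • x' - t • x - xs‖ ^ 2
        - (t + 1) ^ 2 * ‖x' - xh‖ ^ 2) := by
  have h1 := mul_le_mul_of_nonneg_left (hsub x).le ht
  have h2 := hsub xs
  have h3 : t * ⟪ξ, x - x'⟫ + ⟪ξ, xs - x'⟫ = ⟪ξ, xs + t • x - (t + 1) • x'⟫ := by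
    rw [show xs + t • x - (t + 1) • x' = t • (x - x') + (xs - x') by module, inner_add_right,
      inner_smul_right]
  have h4 : ξ = -((ρ * (t + 1)) • ContinuousLinearMap.adjoint A s
      + (γ * (t + 1)) • (x' - xh)) := by
    rw [add_assoc] at hopt
    exact eq_neg_of_add_eq_zero_left hopt
  have h5 : ⟪ξ, xs + t • x - (t + 1) • x'⟫
      = -(ρ * (t + 1) * ⟪s, A xs + t • A x - (t + 1) • A x'⟫
        + γ * (t + 1) * ⟪x' - xh, xs + t • x - (t + 1) • x'⟫) := by
    rw [h4, inner_neg_left, inner_add_left, real_inner_smul_left, real_inner_smul_left,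
      ContinuousLinearMap.adjoint_inner_left, map_sub, map_add, map_smul, map_smul]
  have h6 := norm_add_sq_real ((t + 1) • (x' - xh)) (xs + t • x - (t + 1) • x')
  rw [norm_smul, mul_pow, Real.norm_eq_abs, sq_abs, real_inner_smul_left,
    show (t + 1) • (x' - xh) + (xs + t • x - (t + 1) • x')
      = -((t + 1) • xh - t • x - xs) by module,
    show xs + t • x - (t + 1) • x' = -((t + 1) • x' - t • x - xs) by module,
    norm_neg, norm_neg] at h6
  rw [show xs + t • x - (t + 1) • x' = -((t + 1) • x' - t • x - xs) by module] at h3 h5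
  rw [h5] at h3
  linear_combination h1 + h2 - h3 - γ / 2 * h6

lemma extrapolation_smul {E : Type*} [AddCommGroup E] [Module ℝ E] {x x' xh : E} {t : ℝ}
    (ht : 0 ≤ t) (h : xh = x' + (t / (t + 2)) • (x' - x)) :
    (t + 1 + 1) • xh - (t + 1) • x' = (t + 1) • x' - t • x := by
  have h2 : (t + 2) * (t / (t + 2)) = t := mul_div_cancel₀ t (by linarith)
  have h3 : (t + 2) • xh = (t + 2) • x' + t • (x' - x) := by
    rw [h, smul_add, smul_smul, h2]
  rw [show t + 1 + 1 = t + 2 by ring, h3]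
  module

/-- (Theorem 1: convergence of Algorithm 1 / PAPA.) With
`ρ_k = ρ₀(k+1)`, `γ_k = γ₀(k+1)`, the subproblem optimality conditions and the momentum
update with weight `k/(k+2)`, for every `k ≥ 1`:
`|F(zᵏ) − F⋆| ≤ max{ρ₀R_p², 2‖λ⋆‖R_d}/(2ρ₀k)` and
`dist_K(A xᵏ + B yᵏ − c) ≤ R_d/(ρ₀k)`, where
`R_p² = γ₀‖x⁰−x⋆‖² + ρ₀‖B‖²‖y⁰−y⋆‖²` and `R_d = ‖λ⋆‖ + √(‖λ⋆‖² + ρ₀R_p²)`. -/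
theorem stmt_11
    {H1 H2 H : Type*}
    [NormedAddCommGroup H1] [InnerProductSpace ℝ H1] [CompleteSpace H1]
    [NormedAddCommGroup H2] [InnerProductSpace ℝ H2] [CompleteSpace H2]
    [NormedAddCommGroup H] [InnerProductSpace ℝ H] [CompleteSpace H]
    (A : H1 →L[ℝ] H) (B : H2 →L[ℝ] H) (c : H) (K : Set H)
    (hKne : K.Nonempty) (hKcl : IsClosed K) (hKcv : Convex ℝ K)
    (P : H → H) (hPmem : ∀ u, P u ∈ K)
    (hPproj : ∀ u, ∀ w ∈ K, ⟪u - P u, w - P u⟫ ≤ 0)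
    (f : H1 → ℝ) (g : H2 → ℝ)
    (hf : ConvexOn ℝ Set.univ f) (hg : ConvexOn ℝ Set.univ g)
    (xs : H1) (ys : H2) (lams : H)
    (hfeas : A xs + B ys - c ∈ K)
    (hsaddle : ∀ (x : H1) (y : H2), ∀ r ∈ K,
      f x + g y - ⟪lams, A x + B y - r - c⟫ ≥ f xs + g ys)
    (ρ0 γ0 : ℝ) (hρ0 : 0 < ρ0) (hγ0 : 0 ≤ γ0)
    (x : ℕ → H1) (y : ℕ → H2) (xh : ℕ → H1) (yh : ℕ → H2)
    (hx0 : xh 0 = x 0) (hy0 : yh 0 = y 0)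
    (hxsub : ∀ k : ℕ, ∃ ξ : H1,
      (∀ x' : H1, f x' ≥ f (x (k+1)) + ⟪ξ, x' - x (k+1)⟫) ∧
      ξ + (ρ0 * ((k : ℝ) + 1)) • (ContinuousLinearMap.adjoint A
            ((A (x (k+1)) + B (yh k) - c) - P (A (x (k+1)) + B (yh k) - c)))
        + (γ0 * ((k : ℝ) + 1)) • (x (k+1) - xh k) = 0)
    (hysub : ∀ k : ℕ, ∃ η : H2,
      (∀ y' : H2, g y' ≥ g (y (k+1)) + ⟪η, y' - y (k+1)⟫) ∧
      η + (ρ0 * ((k : ℝ) + 1)) • (ContinuousLinearMap.adjoint B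
            ((A (x (k+1)) + B (yh k) - c) - P (A (x (k+1)) + B (yh k) - c)))
        + (ρ0 * ((k : ℝ) + 1) * ‖B‖ ^ 2) • (y (k+1) - yh k) = 0)
    (hmomx : ∀ k : ℕ, xh (k+1) = x (k+1) + ((k : ℝ)/((k : ℝ) + 2)) • (x (k+1) - x k))
    (hmomy : ∀ k : ℕ, yh (k+1) = y (k+1) + ((k : ℝ)/((k : ℝ) + 2)) • (y (k+1) - y k)) :
    ∀ k : ℕ, 1 ≤ k →
      |(f (x k) + g (y k)) - (f xs + g ys)| ≤
        max (ρ0 * (γ0 * ‖x 0 - xs‖ ^ 2 + ρ0 * ‖B‖ ^ 2 * ‖y 0 - ys‖ ^ 2))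
            (2 * ‖lams‖ * (‖lams‖ + Real.sqrt (‖lams‖ ^ 2
              + ρ0 * (γ0 * ‖x 0 - xs‖ ^ 2 + ρ0 * ‖B‖ ^ 2 * ‖y 0 - ys‖ ^ 2))))
          / (2 * ρ0 * k) ∧
      Metric.infDist (A (x k) + B (y k) - c) K ≤
        (‖lams‖ + Real.sqrt (‖lams‖ ^ 2
            + ρ0 * (γ0 * ‖x 0 - xs‖ ^ 2 + ρ0 * ‖B‖ ^ 2 * ‖y 0 - ys‖ ^ 2)))
          / (ρ0 * k) := by
  intro k hk
  set R2 := γ0 * ‖x 0 - xs‖ ^ 2 + ρ0 * ‖B‖ ^ 2 * ‖y 0 - ys‖ ^ 2 with hR2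
  let v : ℕ → H := fun n ↦ A (x n) + B (y n) - c
  have energy : ∀ n : ℕ,
      n * (f (x n) + g (y n) - (f xs + g ys)) + ρ0 * n ^ 2 * ‖v n - P (v n)‖ ^ 2 / 2
        + γ0 / 2 * ‖((n : ℝ) + 1) • xh n - (n : ℝ) • x n - xs‖ ^ 2
        + ρ0 * ‖B‖ ^ 2 / 2 * ‖((n : ℝ) + 1) • yh n - (n : ℝ) • y n - ys‖ ^ 2 ≤ R2 / 2 := by
    intro n
    induction n with
    | zero =>
      simp only [Nat.cast_zero, zero_mul, zero_add, one_smul, zero_smul, sub_zero, hx0, hy0, hR2]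
      linarith
    | succ n ih =>
      obtain ⟨ξ, hξ, hξ0⟩ := hxsub n
      obtain ⟨η, hη, hη0⟩ := hysub n
      have ht : (0 : ℝ) ≤ n := n.cast_nonneg
      rw [mul_right_comm ρ0] at hη0
      have h1 := proximal_step_le A f (x := x n) (xs := xs) ht hξ hξ0
      have h2 := proximal_step_le B g (x := y n) (xs := ys) ht hη hη0
      set u := A (x (n + 1)) + B (yh n) - c with hu
      have h3 := half_sq_norm_sub_proj_step hPmem hPproj ht u (v n) (v (n + 1)) hfeas
      have h4 : ‖v (n + 1) - u‖ ^ 2 ≤ ‖B‖ ^ 2 * ‖y (n + 1) - yh n‖ ^ 2 := by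
        rw [show v (n + 1) - u = B (y (n + 1) - yh n) by simp only [v, hu, map_sub]; abel,
          ← mul_pow]
        exact pow_le_pow_left₀ (norm_nonneg _) (B.le_opNorm _) 2
      rw [show A xs + B ys - c + (n : ℝ) • v n - ((n : ℝ) + 1) • v (n + 1)
          = (A xs + (n : ℝ) • A (x n) - ((n : ℝ) + 1) • A (x (n + 1)))
            + (B ys + (n : ℝ) • B (y n) - ((n : ℝ) + 1) • B (y (n + 1))) by
          simp only [v]; module, inner_add_right] at h3
      have h3' := mul_le_mul_of_nonneg_left h3 hρ0.le
      have h4' := mul_le_mul_of_nonneg_left h4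
        (mul_nonneg hρ0.le (sq_nonneg ((n : ℝ) + 1)))
      have h5 : 0 ≤ γ0 * (((n : ℝ) + 1) ^ 2 * ‖x (n + 1) - xh n‖ ^ 2) := by positivity
      push_cast
      rw [extrapolation_smul ht (hmomx n), extrapolation_smul ht (hmomy n)]
      linear_combination h1 + h2 + h3' + h4' / 2 + h5 / 2 + ih
  have hk0 : (0 : ℝ) < k := by exact_mod_cast hk
  set D := f (x k) + g (y k) - (f xs + g ys) with hD
  set d := ‖v k - P (v k)‖ with hd
  have hd0 : 0 ≤ d := norm_nonneg _
  have hupper : k * D + ρ0 * k ^ 2 * d ^ 2 / 2 ≤ R2 / 2 := by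
    have h1 := energy k
    have h2 : 0 ≤ γ0 / 2 * ‖((k : ℝ) + 1) • xh k - (k : ℝ) • x k - xs‖ ^ 2 := by positivity
    have h3 : 0 ≤ ρ0 * ‖B‖ ^ 2 / 2 * ‖((k : ℝ) + 1) • yh k - (k : ℝ) • y k - ys‖ ^ 2 := by
      positivity
    linarith
  have hlower : -(‖lams‖ * d) ≤ D := by
    have h1 := hsaddle (x k) (y k) (P (v k)) (hPmem _)
    rw [show A (x k) + B (y k) - P (v k) - c = v k - P (v k) by simp only [v]; abel] at h1
    have h2 := neg_le_of_abs_le (abs_real_inner_le_norm lams (v k - P (v k)))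
    linarith
  set Rd := ‖lams‖ + √(‖lams‖ ^ 2 + ρ0 * R2) with hRd
  have hdist : d ≤ Rd / (ρ0 * k) := by
    rw [le_div_iff₀ (by positivity)]
    have h1 : (ρ0 * k * d - ‖lams‖) ^ 2 ≤ ‖lams‖ ^ 2 + ρ0 * R2 := by
      have h2 := mul_le_mul_of_nonneg_left hlower (mul_pos hρ0 hk0).le
      have h3 := mul_le_mul_of_nonneg_left hupper hρ0.le
      linarith
    have h4 := Real.le_sqrt_of_sq_le h1
    linarith
  refine ⟨?_, (Metric.infDist_le_dist_of_mem (hPmem (v k))).trans ?_⟩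
  · have hden : 0 < 2 * ρ0 * k := by positivity
    rw [abs_le, neg_le, le_div_iff₀ hden, le_div_iff₀ hden]
    constructor
    · refine le_trans ?_ (le_max_right _ _)
      rw [le_div_iff₀ (by positivity)] at hdist
      have h1 := mul_le_mul_of_nonneg_left hdist (norm_nonneg lams)
      have h2 := mul_le_mul_of_nonneg_left hlower hden.le
      linarith
    · refine le_trans ?_ (le_max_left _ _)
      have h1 : 0 ≤ ρ0 * k ^ 2 * d ^ 2 / 2 := by positivity
      have h2 := mul_le_mul_of_nonneg_left (show k * D ≤ R2 / 2 by linarith) hρ0.le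
      linarith
  · rw [dist_eq_norm]
    exact hdist
end

section
/- (Corollary: accelerated proximal scheme for composite minimization, non-strongly convex case.) Let H be a real Hilbert space, f, g : H → ℝ convex with f L_f-Lipschitz continuous (|f(y) − f(y')| ≤ L_f‖y − y'‖ for all y, y'), and suppose P := f + g attains its minimum P* at y* ∈ H. Fix ρ₀ > 0 and set ρ_k := ρ₀(k+1). Let sequences satisfy ŷ⁰ = y⁰ and, for every k ≥ 0: there is a subgradient ξ_k of f at x^{k+1} with ξ_k = ρ_k(ŷ^k − x^{k+1}) (i.e., x^{k+1} = prox_{f/ρ_k}(ŷ^k)); there is a subgradient η_k of g at y^{k+1} with η_k = ρ_k(x^{k+1} − y^{k+1}) (i.e., y^{k+1} = prox_{g/ρ_k}(x^{k+1})); and ŷ^{k+1} = y^{k+1} + (k/(k+2))(y^{k+1} − y^k). Then for every k ≥ 1: P(y^k) − P* ≤ (ρ₀²‖y⁰ − y*‖² + 4L_f² + 2L_f ρ₀‖y⁰ − y*‖) / (2ρ₀ k). -/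
open scoped RealInnerProductSpace

theorem inner_penalty_identity {H : Type*} [NormedAddCommGroup H] [InnerProductSpace ℝ H]
    (u a b e : H) :
    ⟪u - a - e, a⟫ + ⟪a - b + e, b⟫ + ‖a - b + e‖ ^ 2 / 2 =
      ‖u‖ ^ 2 / 2 - ‖b‖ ^ 2 / 2 - ‖u - a‖ ^ 2 / 2 + ‖e‖ ^ 2 / 2 := by
  simp only [← real_inner_self_eq_norm_sq, inner_add_left, inner_sub_left, inner_add_right,
    inner_sub_right]
  rw [real_inner_comm u a, real_inner_comm b a, real_inner_comm e a, real_inner_comm e b]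
  ring

/-- A subgradient inequality tested against the weighted combination of two points. -/
theorem subgradient_weighted_le {H : Type*} [NormedAddCommGroup H] [InnerProductSpace ℝ H]
    {h : H → ℝ} {p ξ : H} (hξ : ∀ z : H, h z ≥ h p + ⟪ξ, z - p⟫) {c : ℝ} (hc : 0 ≤ c) (q s : H) :
    (c + 1) * h p - c * h q - h s ≤ ⟪ξ, (c + 1) • p - c • q - s⟫ := by
  have h₁ := mul_le_mul_of_nonneg_left (hξ q) hc
  have h₂ := hξ s
  simp only [inner_sub_right, inner_smul_right] at *
  linarith

/-- One step of alternating minimization of the quadratic penalty function decreases the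
energy. -/
theorem penalty_energy_step {H : Type*} [NormedAddCommGroup H] [InnerProductSpace ℝ H]
    {f g : H → ℝ} {ρ c : ℝ} (hρ : 0 ≤ ρ) (hc : 0 ≤ c) {x y yh x' y' ξ η : H} (s : H)
    (hξ : ∀ z : H, f z ≥ f x' + ⟪ξ, z - x'⟫) (hξ' : ξ = (ρ * (c + 1)) • (yh - x'))
    (hη : ∀ z : H, g z ≥ g y' + ⟪η, z - y'⟫) (hη' : η = (ρ * (c + 1)) • (x' - y')) :
    (c + 1) * (f x' + g y' - (f s + g s)) + ρ / 2 * ‖(c + 1) • (x' - y')‖ ^ 2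
        + ρ / 2 * ‖(c + 1) • y' - c • y - s‖ ^ 2 ≤
      c * (f x + g y - (f s + g s)) + ρ / 2 * ‖c • (x - y)‖ ^ 2
        + ρ / 2 * ‖(c + 1) • yh - c • y - s‖ ^ 2 := by
  have h₁ := subgradient_weighted_le hξ hc x s
  have h₂ := subgradient_weighted_le hη hc y s
  have key := inner_penalty_identity ((c + 1) • yh - c • y - s) ((c + 1) • x' - c • x - s)
    ((c + 1) • y' - c • y - s) (c • (x - y))
  have e₁ : (c + 1) • yh - c • y - s - ((c + 1) • x' - c • x - s) - c • (x - y)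
      = (c + 1) • (yh - x') := by module
  have e₂ : (c + 1) • x' - c • x - s - ((c + 1) • y' - c • y - s) + c • (x - y)
      = (c + 1) • (x' - y') := by module
  rw [e₁, e₂] at key
  rw [hξ', mul_smul, real_inner_smul_left] at h₁
  rw [hη', mul_smul, real_inner_smul_left] at h₂
  have hsq : 0 ≤ ρ * ‖(c + 1) • yh - c • y - s - ((c + 1) • x' - c • x - s)‖ ^ 2 := by positivity
  linear_combination h₁ + h₂ + ρ * key + hsq / 2

/-- Passing from the quadratic penalty bound to a bound on the exact objective. -/
theorem gap_le_of_penalty_bound {L ρ c D r F G : ℝ} (hL : 0 ≤ L) (hρ : 0 < ρ) (hc : 0 < c)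
    (hD : 0 ≤ D) (hG : 0 ≤ G) (hGF : G ≤ F + L * r)
    (hF : c * F + ρ / 2 * (c * r) ^ 2 ≤ ρ / 2 * D ^ 2) :
    G ≤ (ρ ^ 2 * D ^ 2 + 4 * L ^ 2 + 2 * L * ρ * D) / (2 * ρ * c) := by
  have hrc : ρ * (c * r) ≤ 2 * L + ρ * D := by
    by_contra! hlt
    have hquad : (ρ * (c * r)) ^ 2 - 2 * L * (ρ * (c * r)) ≤ (ρ * D) ^ 2 := by
      have : 0 ≤ c * (F + L * r) := mul_nonneg hc.le (hG.trans hGF)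
      nlinarith
    have hρD : 0 ≤ ρ * D := by positivity
    nlinarith
  rw [le_div_iff₀ (by positivity)]
  have h₁ : ρ * (c * G) ≤ ρ * (c * (F + L * r)) := by gcongr
  have h₂ := mul_le_mul_of_nonneg_left hF hρ.le
  have h₃ := mul_le_mul_of_nonneg_left hrc hL
  have h₄ : 0 ≤ (ρ * (c * r)) ^ 2 := sq_nonneg _
  nlinarith

/-- (Corollary 1, non-strongly convex case.) For the accelerated
proximal scheme `xᵏ⁺¹ = prox_{f/ρ_k}(ŷᵏ)`, `yᵏ⁺¹ = prox_{g/ρ_k}(xᵏ⁺¹)`,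
`ŷᵏ⁺¹ = yᵏ⁺¹ + (k/(k+2))(yᵏ⁺¹ − yᵏ)` with `ρ_k = ρ₀(k+1)`, applied to `P = f + g`
with `f` `L_f`-Lipschitz continuous, for every `k ≥ 1`:
`P(yᵏ) − P⋆ ≤ (ρ₀²‖y⁰−y⋆‖² + 4L_f² + 2L_fρ₀‖y⁰−y⋆‖)/(2ρ₀k)`. -/
theorem stmt_16
    {H : Type*} [NormedAddCommGroup H] [InnerProductSpace ℝ H]
    (f g : H → ℝ)
    (hf : ConvexOn ℝ Set.univ f) (hg : ConvexOn ℝ Set.univ g)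
    (Lf : ℝ) (hLf : 0 ≤ Lf)
    (hLip : ∀ a b : H, |f a - f b| ≤ Lf * ‖a - b‖)
    (ys : H) (hmin : ∀ z : H, f ys + g ys ≤ f z + g z)
    (ρ0 : ℝ) (hρ0 : 0 < ρ0)
    (x : ℕ → H) (y : ℕ → H) (yh : ℕ → H)
    (hyh0 : yh 0 = y 0)
    (hxsub : ∀ k : ℕ, ∃ ξ : H,
      (∀ z : H, f z ≥ f (x (k+1)) + ⟪ξ, z - x (k+1)⟫) ∧
      ξ = (ρ0 * ((k : ℝ) + 1)) • (yh k - x (k+1)))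
    (hysub : ∀ k : ℕ, ∃ η : H,
      (∀ z : H, g z ≥ g (y (k+1)) + ⟪η, z - y (k+1)⟫) ∧
      η = (ρ0 * ((k : ℝ) + 1)) • (x (k+1) - y (k+1)))
    (hmom : ∀ k : ℕ, yh (k+1) = y (k+1) + ((k : ℝ)/((k : ℝ) + 2)) • (y (k+1) - y k)) :
    ∀ k : ℕ, 1 ≤ k →
      (f (y k) + g (y k)) - (f ys + g ys) ≤
        (ρ0 ^ 2 * ‖y 0 - ys‖ ^ 2 + 4 * Lf ^ 2 + 2 * Lf * ρ0 * ‖y 0 - ys‖)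
          / (2 * ρ0 * k) := by
  have energy : ∀ k : ℕ,
      (k : ℝ) * (f (x k) + g (y k) - (f ys + g ys)) + ρ0 / 2 * ‖(k : ℝ) • (x k - y k)‖ ^ 2
        + ρ0 / 2 * ‖((k : ℝ) + 1) • yh k - (k : ℝ) • y k - ys‖ ^ 2
      ≤ ρ0 / 2 * ‖y 0 - ys‖ ^ 2 := by
    intro k
    induction k with
    | zero => simp [hyh0]
    | succ k ih =>
      obtain ⟨ξ, hξ, hξ'⟩ := hxsub k
      obtain ⟨η, hη, hη'⟩ := hysub k
      have step := penalty_energy_step hρ0.le k.cast_nonneg (x := x k) (y := y k) ys hξ hξ' hη hη'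
      have hu : (((k + 1 : ℕ) : ℝ) + 1) • yh (k + 1) - ((k + 1 : ℕ) : ℝ) • y (k + 1) - ys
          = ((k : ℝ) + 1) • y (k + 1) - (k : ℝ) • y k - ys := by
        have hk : (k : ℝ) + 2 ≠ 0 := by positivity
        rw [hmom k]
        push_cast
        match_scalars <;> field_simp <;> ring
      rw [hu]
      push_cast
      exact step.trans ih
  intro k hk
  have hk0 : (0 : ℝ) < k := by exact_mod_cast hk
  refine gap_le_of_penalty_bound (r := ‖x k - y k‖) (F := f (x k) + g (y k) - (f ys + g ys))
    hLf hρ0 hk0 (norm_nonneg _) (sub_nonneg.2 (hmin _)) ?_ ?_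
  · have h := (abs_le.1 (hLip (x k) (y k))).1
    linarith
  · have h := energy k
    rw [norm_smul, Real.norm_of_nonneg hk0.le] at h
    have : 0 ≤ ρ0 / 2 * ‖((k : ℝ) + 1) • yh k - (k : ℝ) • y k - ys‖ ^ 2 := by positivity
    linarith
end

section
/- (Corollary: accelerated proximal scheme for composite minimization, strongly convex case.) Let H be a real Hilbert space, f, g : H → ℝ convex with f L_f-Lipschitz continuous and g μ_g-strongly convex (μ_g > 0), and suppose P := f + g attains its minimum P* at y* ∈ H. Fix ρ₀ ∈ (0, μ_g/2], define τ₀ := 1, τ_{k+1} := (τ_k/2)(√(τ_k² + 4) − τ_k), and ρ_k := ρ₀/τ_k². Let sequences satisfy ỹ⁰ = y⁰ and, for every k ≥ 0: ŷ^k := (1−τ_k)y^k + τ_k ỹ^k; there is a subgradient ξ_k of f at x^{k+1} with ξ_k = ρ_k(ŷ^k − x^{k+1}); there is η_k with η_k = τ_k ρ_k(v^k − ỹ^{k+1}) and g(y) ≥ g(ỹ^{k+1}) + ⟨η_k, y − ỹ^{k+1}⟩ + (μ_g/2)‖y − ỹ^{k+1}‖² for all y, where v^k := (1/τ_k)x^{k+1}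 − ((1−τ_k)/τ_k)y^k; and y^{k+1} := (1−τ_k)y^k + τ_k ỹ^{k+1}. Then for every k ≥ 1: P(y^k) − P* ≤ 2ρ₀‖y⁰ − y*‖²/(k+1)² + 8(L_f² + L_f ρ₀‖y⁰ − y*‖)/(ρ₀ (k+1)²). -/
open scoped RealInnerProductSpace

/-- The momentum recursion `τ' = (τ/2)(√(τ²+4) − τ)` solves `τ'² = (1 − τ')τ²`. -/
lemma sq_eq_of_momentum_rec {s t : ℝ} (h : t = s / 2 * (√(s ^ 2 + 4) - s)) :
    t ^ 2 = (1 - t) * s ^ 2 := by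
  have hr : √(s ^ 2 + 4) ^ 2 = s ^ 2 + 4 := Real.sq_sqrt (by positivity)
  rw [h]
  linear_combination s ^ 2 / 4 * hr

lemma momentum_rec_pos {s t : ℝ} (hs : 0 < s) (h : t = s / 2 * (√(s ^ 2 + 4) - s)) :
    0 < t := by
  have : s < √(s ^ 2 + 4) := Real.lt_sqrt_of_sq_lt (by linarith)
  rw [h]
  exact mul_pos (by linarith) (by linarith)

lemma le_two_mul_of_sq_eq {s t : ℝ} (hs : 0 < s) (hs1 : s ≤ 1) (ht : 0 < t)
    (h : t ^ 2 = (1 - t) * s ^ 2) : s ≤ 2 * t := by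
  by_contra! hlt
  nlinarith [mul_pos hs hs, mul_pos ht ht]

lemma momentum_bound_step {n s t : ℝ} (hn : 0 ≤ n) (hs : 0 < s) (ht : 0 < t)
    (h : t ^ 2 = (1 - t) * s ^ 2) (hb : (n + 2) * s ≤ 2) : (n + 3) * t ≤ 2 := by
  by_contra! hlt
  have ht1 : 0 < 1 - t := by
    by_contra! hc
    nlinarith [mul_pos hs hs, mul_pos ht ht]
  have h1 : (n + 2) ^ 2 * s ^ 2 ≤ 4 := by
    nlinarith [mul_pos (by linarith : (0 : ℝ) < n + 2) hs]
  have h2 : (n + 2) ^ 2 * t ^ 2 ≤ 4 * (1 - t) := by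
    rw [h]
    nlinarith
  nlinarith [mul_pos (by linarith : (0 : ℝ) < n + 3) ht]

lemma momentum_bounds {τ : ℕ → ℝ} (hτ0 : τ 0 = 1)
    (hτrec : ∀ k, τ (k + 1) = τ k / 2 * (√(τ k ^ 2 + 4) - τ k)) (k : ℕ) :
    0 < τ k ∧ ((k : ℝ) + 2) * τ k ≤ 2 := by
  induction k with
  | zero => simp [hτ0]
  | succ k ih =>
    have hpos := momentum_rec_pos ih.1 (hτrec k)
    have := momentum_bound_step (Nat.cast_nonneg k) ih.1 hpos
      (sq_eq_of_momentum_rec (hτrec k)) ih.2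
    refine ⟨hpos, ?_⟩
    push_cast
    linarith

/-- One accelerated step, measured by the smoothed value `f x + ρ/2 * ‖x - y‖² + g y`. The
right-hand side uses an arbitrary point `u` and the smaller parameter `(1 - t)ρ`. -/
lemma accelerated_prox_step {H : Type*} [NormedAddCommGroup H] [InnerProductSpace ℝ H]
    {f g : H → ℝ} (hg : ConvexOn ℝ Set.univ g) {μ ρ t : ℝ} (hρ : 0 ≤ ρ) (ht0 : 0 ≤ t)
    (ht1 : t ≤ 1) {x y w y' w' : H} (z u : H) (hy' : y' = (1 - t) • y + t • w')
    (hf : ∀ a, f x + ⟪ρ • ((1 - t) • y + t • w - x), a - x⟫ ≤ f a)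
    (hgz : g w' + ⟪ρ • (x - y'), z - w'⟫ + μ / 2 * ‖z - w'‖ ^ 2 ≤ g z) :
    f x + ρ / 2 * ‖x - y'‖ ^ 2 + g y' - (f z + g z) ≤
      (1 - t) * (f u + (1 - t) * ρ / 2 * ‖u - y‖ ^ 2 + g y - (f z + g z))
        + ρ * t ^ 2 / 2 * (‖w - z‖ ^ 2 - ‖w' - z‖ ^ 2) - t * μ / 2 * ‖w' - z‖ ^ 2 := by
  have hgy : g y' ≤ (1 - t) * g y + t * g w' := by
    rw [hy']
    exact hg.2 trivial trivial (sub_nonneg.2 ht1) ht0 (by ring)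
  have hfu := mul_le_mul_of_nonneg_left (hf u) (sub_nonneg.2 ht1)
  have hfz := mul_le_mul_of_nonneg_left (hf z) ht0
  have hgz' := mul_le_mul_of_nonneg_left hgz ht0
  have key : (1 - t) * ⟪ρ • ((1 - t) • y + t • w - x), u - x⟫
      + t * ⟪ρ • ((1 - t) • y + t • w - x), z - x⟫ + t * ⟪ρ • (x - y'), z - w'⟫
      + (1 - t) * ((1 - t) * ρ / 2 * ‖u - y‖ ^ 2)
      + ρ * t ^ 2 / 2 * (‖w - z‖ ^ 2 - ‖w' - z‖ ^ 2) - ρ / 2 * ‖x - y'‖ ^ 2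
      = ρ / 2 * ‖(1 - t) • y + t • w - x + (1 - t) • (u - y)‖ ^ 2 := by
    rw [hy']
    simp only [← real_inner_self_eq_norm_sq, inner_add_left, inner_add_right, inner_sub_left,
      inner_sub_right, real_inner_smul_left, real_inner_smul_right]
    rw [real_inner_comm y x, real_inner_comm w x, real_inner_comm w' x, real_inner_comm z x,
      real_inner_comm u x, real_inner_comm w y, real_inner_comm w' y, real_inner_comm z y,
      real_inner_comm u y, real_inner_comm z w, real_inner_comm u w, real_inner_comm z w']
    ring
  have hsq : 0 ≤ ρ / 2 * ‖(1 - t) • y + t • w - x + (1 - t) • (u - y)‖ ^ 2 := by positivity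
  rw [norm_sub_rev z w'] at hgz'
  linarith

/-- (Corollary 1, strongly convex case.) For the accelerated proximal
scheme (3.10) applied to `P = f + g` with `f` `L_f`-Lipschitz and `g` `μ_g`-strongly
convex, with `τ₀ = 1`, `τ_{k+1} = (τ_k/2)(√(τ_k²+4) − τ_k)`, `ρ_k = ρ₀/τ_k²`,
`ρ₀ ∈ (0, μ_g/2]`, for every `k ≥ 1`:
`P(yᵏ) − P⋆ ≤ 2ρ₀‖y⁰−y⋆‖²/(k+1)² + 8(L_f² + L_fρ₀‖y⁰−y⋆‖)/(ρ₀(k+1)²)`. -/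
theorem stmt_17
    {H : Type*} [NormedAddCommGroup H] [InnerProductSpace ℝ H]
    (f g : H → ℝ)
    (hf : ConvexOn ℝ Set.univ f)
    (μ : ℝ) (hμ : 0 < μ)
    (hg : ConvexOn ℝ Set.univ (fun z : H => g z - μ/2 * ‖z‖ ^ 2))
    (Lf : ℝ) (hLf : 0 ≤ Lf)
    (hLip : ∀ a b : H, |f a - f b| ≤ Lf * ‖a - b‖)
    (ys : H) (hmin : ∀ z : H, f ys + g ys ≤ f z + g z)
    (ρ0 : ℝ) (hρ0 : 0 < ρ0) (hρ0' : ρ0 ≤ μ / 2)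
    (τ : ℕ → ℝ) (hτ0 : τ 0 = 1)
    (hτrec : ∀ k : ℕ, τ (k+1) = τ k / 2 * (Real.sqrt (τ k ^ 2 + 4) - τ k))
    (x : ℕ → H) (y : ℕ → H) (yt : ℕ → H)
    (hyt0 : yt 0 = y 0)
    (hxsub : ∀ k : ℕ, ∃ ξ : H,
      (∀ z : H, f z ≥ f (x (k+1)) + ⟪ξ, z - x (k+1)⟫) ∧
      ξ = (ρ0 / τ k ^ 2) • (((1 - τ k) • y k + τ k • yt k) - x (k+1)))
    (hysub : ∀ k : ℕ, ∃ η : H,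
      (η = (τ k * (ρ0 / τ k ^ 2)) •
        (((1/τ k) • x (k+1) - ((1 - τ k)/τ k) • y k) - yt (k+1))) ∧
      (∀ z : H, g z ≥ g (yt (k+1)) + ⟪η, z - yt (k+1)⟫
        + (μ/2) * ‖z - yt (k+1)‖ ^ 2))
    (hyk1 : ∀ k : ℕ, y (k+1) = (1 - τ k) • y k + τ k • yt (k+1)) :
    ∀ k : ℕ, 1 ≤ k →
      (f (y k) + g (y k)) - (f ys + g ys) ≤
        2 * ρ0 * ‖y 0 - ys‖ ^ 2 / ((k : ℝ) + 1) ^ 2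
          + 8 * (Lf ^ 2 + Lf * ρ0 * ‖y 0 - ys‖) / (ρ0 * ((k : ℝ) + 1) ^ 2) := by
  have hτ := momentum_bounds hτ0 hτrec
  have hτ1 (k : ℕ) : τ k ≤ 1 := by
    nlinarith [(hτ k).1, (hτ k).2, (Nat.cast_nonneg k : (0 : ℝ) ≤ k)]
  have hgc : ConvexOn ℝ Set.univ g :=
    (strongConvexOn_iff_convex.2 hg).convexOn fun r => by positivity
  have hfx (k : ℕ) (a : H) : f (x (k + 1)) + ⟪(ρ0 / τ k ^ 2) •
      ((1 - τ k) • y k + τ k • yt k - x (k + 1)), a - x (k + 1)⟫ ≤ f a := by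
    obtain ⟨ξ, hξ, rfl⟩ := hxsub k
    exact hξ a
  have hgy (k : ℕ) : g (yt (k + 1)) + ⟪(ρ0 / τ k ^ 2) • (x (k + 1) - y (k + 1)),
      ys - yt (k + 1)⟫ + μ / 2 * ‖ys - yt (k + 1)‖ ^ 2 ≤ g ys := by
    obtain ⟨η, rfl, hη⟩ := hysub k
    have hpos := (hτ k).1
    convert hη ys using 4
    rw [hyk1, mul_comm (τ k), mul_smul]
    congr 1
    match_scalars <;> field_simp
  have step (k : ℕ) (u : H) := accelerated_prox_step (f := f) (μ := μ) hgc
    (div_nonneg hρ0.le (sq_nonneg (τ k))) (hτ k).1.le (hτ1 k) ys u (hyk1 k) (hfx k) (hgy k)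
  have potential (k : ℕ) : f (x (k + 1)) + ρ0 / τ k ^ 2 / 2 * ‖x (k + 1) - y (k + 1)‖ ^ 2
      + g (y (k + 1)) - (f ys + g ys) + ρ0 / 2 * (1 + 2 * τ k) * ‖yt (k + 1) - ys‖ ^ 2
      ≤ τ k ^ 2 * (ρ0 / 2 * ‖y 0 - ys‖ ^ 2) := by
    induction k with
    | zero =>
      have h := step 0 (y 0)
      have := mul_le_mul_of_nonneg_right hρ0' (sq_nonneg ‖yt 1 - ys‖)
      simp only [hτ0, hyt0, zero_add] at h ⊢
      norm_num at h ⊢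
      linarith
    | succ k ih =>
      have h := step (k + 1) (x (k + 1))
      have hs := (hτ k).1
      have ht := (hτ (k + 1)).1
      have hst := sq_eq_of_momentum_rec (hτrec k)
      have h2 := le_two_mul_of_sq_eq hs (hτ1 k) ht hst
      have hρ : (1 - τ (k + 1)) * (ρ0 / τ (k + 1) ^ 2) = ρ0 / τ k ^ 2 := by
        field_simp
        linarith
      have hρt : ρ0 / τ (k + 1) ^ 2 * τ (k + 1) ^ 2 = ρ0 := by field_simp
      rw [hρ, hρt] at h
      have ih' := mul_le_mul_of_nonneg_left ih (sub_nonneg.2 (hτ1 (k + 1)))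
      have hμ' := mul_le_mul_of_nonneg_right (mul_le_mul_of_nonneg_left hρ0' ht.le)
        (sq_nonneg ‖yt (k + 1 + 1) - ys‖)
      have hcoef : 1 ≤ (1 - τ (k + 1)) * (1 + 2 * τ k) := by
        have : 0 ≤ τ k * (2 * (1 - τ (k + 1)) * τ k - τ (k + 1)) := by nlinarith
        nlinarith [nonneg_of_mul_nonneg_right this hs]
      have ha := mul_le_mul_of_nonneg_right hcoef
        (by positivity : 0 ≤ ρ0 / 2 * ‖yt (k + 1) - ys‖ ^ 2)
      rw [← mul_assoc (1 - τ (k + 1)) (τ k ^ 2), ← hst] at ih'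
      linarith
  intro k hk
  obtain ⟨k, rfl⟩ := Nat.exists_eq_add_of_le' hk
  have hpos := (hτ k).1
  have hP := potential k
  have hL := (le_abs_self _).trans (hLip (y (k + 1)) (x (k + 1)))
  rw [norm_sub_rev] at hL
  have hsmooth : Lf * ‖x (k + 1) - y (k + 1)‖ ≤
      ρ0 / τ k ^ 2 / 2 * ‖x (k + 1) - y (k + 1)‖ ^ 2 + τ k ^ 2 * (Lf ^ 2 / (2 * ρ0)) := by
    have : ρ0 / τ k ^ 2 / 2 * ‖x (k + 1) - y (k + 1)‖ ^ 2 + τ k ^ 2 * (Lf ^ 2 / (2 * ρ0))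
        - Lf * ‖x (k + 1) - y (k + 1)‖
        = ρ0 / τ k ^ 2 / 2 * (‖x (k + 1) - y (k + 1)‖ - Lf * τ k ^ 2 / ρ0) ^ 2 := by
      field_simp
      ring
    have : 0 ≤ ρ0 / τ k ^ 2 / 2 * (‖x (k + 1) - y (k + 1)‖ - Lf * τ k ^ 2 / ρ0) ^ 2 := by
      positivity
    linarith
  have hτsq : τ k ^ 2 ≤ 4 / ((k : ℝ) + 2) ^ 2 := by
    rw [le_div_iff₀ (by positivity), ← mul_pow, mul_comm]
    nlinarith [(hτ k).2, mul_pos (by positivity : (0 : ℝ) < k + 2) hpos]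
  have ha : 0 ≤ ρ0 / 2 * (1 + 2 * τ k) * ‖yt (k + 1) - ys‖ ^ 2 := by positivity
  calc f (y (k + 1)) + g (y (k + 1)) - (f ys + g ys)
      ≤ τ k ^ 2 * (ρ0 / 2 * ‖y 0 - ys‖ ^ 2 + Lf ^ 2 / (2 * ρ0)) := by linarith
    _ ≤ 4 / ((k : ℝ) + 2) ^ 2 * (ρ0 / 2 * ‖y 0 - ys‖ ^ 2 + Lf ^ 2 / (2 * ρ0)) := by gcongr
    _ ≤ 4 / ((k : ℝ) + 2) ^ 2 * (ρ0 / 2 * ‖y 0 - ys‖ ^ 2 + Lf ^ 2 / (2 * ρ0))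
        + (6 * Lf ^ 2 + 8 * (Lf * ρ0 * ‖y 0 - ys‖)) / (ρ0 * ((k : ℝ) + 2) ^ 2) :=
      le_add_of_nonneg_right (by positivity)
    _ = _ := by
      push_cast
      rw [show (k : ℝ) + 1 + 1 = k + 2 by ring]
      field_simp
      ring
end

section
/- Let H be a real Hilbert space, f, g : H → ℝ with f L_f-Lipschitz continuous, and suppose P := f + g attains its minimum P* over H. For ρ > 0 and x, y ∈ H define S_ρ(x,y) := f(x) + g(y) + (ρ/2)‖x − y‖² − P*. Then: (i) 0 ≤ P(y) − P* ≤ S_ρ(x,y) − (ρ/2)‖x − y‖² + L_f‖x − y‖, and consequently (ii) ‖x − y‖ ≤ (1/ρ)(L_f + √(L_f² + 2ρ S_ρ(x,y))). -/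
/-- For `P = f + g` with `f` `L_f`-Lipschitz continuous and minimum
`P⋆` attained at `y⋆`, and `S_ρ(x,y) := f x + g y + (ρ/2)‖x−y‖² − P⋆`:
(i) `0 ≤ P(y) − P⋆ ≤ S_ρ(x,y) − (ρ/2)‖x−y‖² + L_f‖x−y‖`, and
(ii) `‖x−y‖ ≤ (1/ρ)(L_f + √(L_f² + 2ρ S_ρ(x,y)))`. -/
theorem stmt_18
    {H : Type*} [NormedAddCommGroup H] [InnerProductSpace ℝ H]
    (f g : H → ℝ)
    (Lf : ℝ) (hLf : 0 ≤ Lf)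
    (hLip : ∀ a b : H, |f a - f b| ≤ Lf * ‖a - b‖)
    (ys : H) (hmin : ∀ z : H, f ys + g ys ≤ f z + g z)
    (ρ : ℝ) (hρ : 0 < ρ) :
    ∀ x y : H,
      (0 ≤ (f y + g y) - (f ys + g ys)) ∧
      ((f y + g y) - (f ys + g ys) ≤
        ((f x + g y + (ρ/2) * ‖x - y‖ ^ 2) - (f ys + g ys))
          - (ρ/2) * ‖x - y‖ ^ 2 + Lf * ‖x - y‖) ∧
      (‖x - y‖ ≤ (1/ρ) * (Lf + Real.sqrt (Lf ^ 2
        + 2 * ρ * ((f x + g y + (ρ/2) * ‖x - y‖ ^ 2) - (f ys + g ys))))) := by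
  intro x y
  have hy := hmin y
  have hxy : f y - f x ≤ Lf * ‖x - y‖ := by
    have h := hLip x y
    linarith [neg_abs_le (f x - f y)]
  refine ⟨by linarith, by linarith, ?_⟩
  rw [one_div, inv_mul_eq_div, le_div_iff₀ hρ]
  have hS : 0 ≤ (f x + g y + Lf * ‖x - y‖) - (f ys + g ys) := by linarith
  have hsq : (ρ * ‖x - y‖ - Lf) ^ 2 ≤ Lf ^ 2
      + 2 * ρ * ((f x + g y + (ρ/2) * ‖x - y‖ ^ 2) - (f ys + g ys)) := by
    linarith [mul_nonneg hρ.le hS]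
  linarith [Real.le_sqrt_of_sq_le hsq]
end

section
/- (Theorem on three objective terms, Algorithm 1 variant.) Let h : H2 → ℝ be convex and differentiable with L_h-Lipschitz gradient, let f : H1 → ℝ and g : H2 → ℝ be convex, and set F(x,y) := f(x) + g(y) + h(y). Suppose (x*, y*, λ*) satisfies A x* + B y* − c ∈ K, F* := f(x*) + g(y*) + h(y*), and f(x) + g(y) + h(y) − ⟨λ*, A x + B y − r − c⟩ ≥ F* for all x ∈ H1, y ∈ H2, r ∈ K. Fix ρ₀ > 0, γ₀ ≥ 0, set ρ_k := ρ₀(k+1), γ_k := γ₀(k+1), β̂_k := ρ_k‖B‖² + L_h. Let sequences satisfy x̂⁰ = x⁰, ŷ⁰ = y⁰ and, for every k ≥ 0: there is a subgradient ξ_k of f at x^{k+1} with ξ_k + ρ_k A* ŝ^{k+1} + γ_k(x^{k+1} − x̂^k) = 0, where ŝ^{k+1} := (A x^{k+1} + B ŷ^k − c) − P_K(A x^{k+1} + B ŷ^k − c); there is a subgradient η_k of g at y^{k+1} with η_k + ∇h(ŷ^k) + ρ_k B* ŝ^{k+1} + β̂_k(y^{k+1} − ŷ^k) = 0; and (x̂^{k+1},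 ŷ^{k+1}) = (x^{k+1}, y^{k+1}) + (k/(k+2))·((x^{k+1}, y^{k+1}) − (x^k, y^k)). Then for every k ≥ 1: |F(x^k, y^k) − F*| ≤ max{ρ₀ R_p², 2‖λ*‖ R_d}/(2ρ₀ k) and dist_K(A x^k + B y^k − c) ≤ R_d/(ρ₀ k), where R_p² := γ₀‖x⁰ − x*‖² + (L_h + ρ₀‖B‖²)‖y⁰ − y*‖² and R_d := ‖λ*‖ + √(‖λ*‖² + ρ₀ R_p²). -/
open scoped RealInnerProductSpace

section Gradient

variable {E : Type*} [NormedAddCommGroup E] [InnerProductSpace ℝ E] [CompleteSpace E]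

lemma HasGradientAt.hasDerivAt_comp_add_smul {h : E → ℝ} {h' : E → E}
    (hgrad : ∀ y, HasGradientAt h (h' y) y) (a d : E) (t : ℝ) :
    HasDerivAt (fun t : ℝ => h (a + t • d)) ⟪h' (a + t • d), d⟫ t := by
  have hline : HasDerivAt (fun t : ℝ => a + t • d) d t := by
    simpa using ((hasDerivAt_id t).smul_const d).const_add a
  exact (hgrad (a + t • d)).hasFDerivAt.comp_hasDerivAt t hline

/-- The gradient inequality for a convex function. -/
lemma ConvexOn.add_inner_gradient_le {h : E → ℝ} {h' : E → E}
    (hh : ConvexOn ℝ Set.univ h) (hgrad : ∀ y, HasGradientAt h (h' y) y) (a b : E) :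
    h a + ⟪h' a, b - a⟫ ≤ h b := by
  have hconv : ConvexOn ℝ Set.univ (fun t : ℝ => h (a + t • (b - a))) := by
    have := hh.comp_affineMap (AffineMap.lineMap (k := ℝ) a b)
    simpa [Function.comp_def, AffineMap.lineMap_apply, add_comm] using this
  have hslope := hconv.le_slope_of_hasDerivAt (Set.mem_univ 0) (Set.mem_univ 1) one_pos
    (HasGradientAt.hasDerivAt_comp_add_smul hgrad a (b - a) 0)
  simp [slope_def_field] at hslope
  linarith

/-- The descent lemma for a function with Lipschitz gradient. -/
lemma le_add_inner_gradient_add_sq {h : E → ℝ} {h' : E → E}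
    (hgrad : ∀ y, HasGradientAt h (h' y) y) {L : ℝ}
    (hLip : ∀ a b, ‖h' a - h' b‖ ≤ L * ‖a - b‖) (a b : E) :
    h b ≤ h a + ⟪h' a, b - a⟫ + L / 2 * ‖b - a‖ ^ 2 := by
  set d := b - a with hd
  have hder : ∀ t : ℝ, HasDerivAt
      (fun t : ℝ => h (a + t • d) - t * ⟪h' a, d⟫ - L / 2 * ‖d‖ ^ 2 * t ^ 2)
      (⟪h' (a + t • d), d⟫ - ⟪h' a, d⟫ - L * ‖d‖ ^ 2 * t) t := by
    intro t
    have h1 := HasGradientAt.hasDerivAt_comp_add_smul hgrad a d t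
    have h2 : HasDerivAt (fun t : ℝ => t * ⟪h' a, d⟫) ⟪h' a, d⟫ t := by
      simpa using (hasDerivAt_id t).mul_const ⟪h' a, d⟫
    have h3 : HasDerivAt (fun t : ℝ => L / 2 * ‖d‖ ^ 2 * t ^ 2) (L * ‖d‖ ^ 2 * t) t := by
      refine ((hasDerivAt_pow 2 t).const_mul (L / 2 * ‖d‖ ^ 2)).congr_deriv ?_
      push_cast
      ring
    exact (h1.sub h2).sub h3
  have hanti := antitoneOn_of_hasDerivWithinAt_nonpos (convex_Icc (0 : ℝ) 1)
    (fun t _ => (hder t).continuousAt.continuousWithinAt)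
    (fun t _ => (hder t).hasDerivWithinAt) (fun t ht => by
      have ht0 : 0 ≤ t := (interior_subset ht).1
      have h1 : ⟪h' (a + t • d) - h' a, d⟫ ≤ L * (t * ‖d‖) * ‖d‖ := by
        refine (real_inner_le_norm _ _).trans ?_
        gcongr
        have := hLip (a + t • d) a
        rwa [add_sub_cancel_left, norm_smul, Real.norm_of_nonneg ht0] at this
      rw [inner_sub_left] at h1
      nlinarith)
  have := hanti (Set.left_mem_Icc.2 zero_le_one) (Set.right_mem_Icc.2 zero_le_one) zero_le_one
  simp [hd] at this ⊢
  linarith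

end Gradient

/-- One step of an accelerated proximal scheme, with the inexactness `e` in the subgradient
inequality. -/
lemma accelerated_prox_step_s19 {E H : Type*}
    [NormedAddCommGroup E] [InnerProductSpace ℝ E] [CompleteSpace E]
    [NormedAddCommGroup H] [InnerProductSpace ℝ H] [CompleteSpace H]
    (T : E →L[ℝ] H) {G : E → ℝ} {ζ z zn zh zt zs : E} {s : H} {e θ b n : ℝ}
    (hn : 1 ≤ n) (hsub : ∀ w, G zn + ⟪ζ, w - zn⟫ - e ≤ G w)
    (hopt : ζ + θ • ContinuousLinearMap.adjoint T s + (b * n) • (zn - zh) = 0)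
    (hzh : n • zh = (n - 1) • z + zt) :
    n * G zn ≤ (n - 1) * G z + G zs + n * e
      - θ * ⟪s, T (n • zn - (n - 1) • z - zs)⟫
      - b / 2 * (n ^ 2 * ‖zn - zh‖ ^ 2 + ‖n • zn - (n - 1) • z - zs‖ ^ 2 - ‖zt - zs‖ ^ 2) := by
  set D := n • zn - (n - 1) • z - zs with hD
  have hζ : ⟪ζ, D⟫ = -(θ * ⟪s, T D⟫) - b * ⟪n • (zn - zh), D⟫ := by
    have h0 : ⟪ζ + θ • ContinuousLinearMap.adjoint T s + (b * n) • (zn - zh), D⟫ = 0 := by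
      rw [hopt, inner_zero_left]
    simp only [inner_add_left, real_inner_smul_left,
      ContinuousLinearMap.adjoint_inner_left] at h0 ⊢
    linarith
  have hzt : zt - zs = D - n • (zn - zh) := by
    rw [smul_sub, hzh, hD]; abel
  have hnorm : ‖n • (zn - zh)‖ ^ 2 = n ^ 2 * ‖zn - zh‖ ^ 2 := by
    rw [norm_smul, mul_pow, Real.norm_eq_abs, sq_abs]
  have hexp := norm_sub_sq_real D (n • (zn - zh))
  rw [← hzt, hnorm, real_inner_comm] at hexp
  have hsum : ⟪ζ, D⟫ = -((n - 1) * ⟪ζ, z - zn⟫ + ⟪ζ, zs - zn⟫) := by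
    have : D = -((n - 1) • (z - zn) + (zs - zn)) := by
      rw [hD]; module
    rw [this, inner_neg_right, inner_add_right, real_inner_smul_right]
  have h1 := mul_le_mul_of_nonneg_left (hsub z) (sub_nonneg.2 hn)
  have h2 := hsub zs
  rw [hexp]
  linarith

section Projection

variable {H : Type*} [NormedAddCommGroup H] [InnerProductSpace ℝ H] {K : Set H} {P : H → H}

lemma norm_sub_sq_le_of_proj (hPproj : ∀ u, ∀ w ∈ K, ⟪u - P u, w - P u⟫ ≤ 0)
    (v : H) {p : H} (hp : p ∈ K) : ‖v - P v‖ ^ 2 ≤ ‖v - p‖ ^ 2 := by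
  have h1 := hPproj v p hp
  have h2 := norm_sub_sq_real (v - P v) (p - P v)
  rw [sub_sub_sub_cancel_right] at h2
  nlinarith [sq_nonneg ‖p - P v‖]

/-- The quadratic penalty of the distance to `K` along an accelerated step. -/
lemma accelerated_penalty_step (hPmem : ∀ u, P u ∈ K)
    (hPproj : ∀ u, ∀ w ∈ K, ⟪u - P u, w - P u⟫ ≤ 0)
    (u v w : H) {ws : H} (hws : ws ∈ K) {n : ℝ} (hn : 1 ≤ n) :
    n ^ 2 / 2 * ‖v - P v‖ ^ 2 ≤ (n - 1) ^ 2 / 2 * ‖w - P w‖ ^ 2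
      + n * ⟪u - P u, n • v - (n - 1) • w - ws⟫ + n ^ 2 / 2 * ‖v - u‖ ^ 2 := by
  have hv := norm_sub_sq_le_of_proj hPproj v (hPmem u)
  have hq := hPproj u (P w) (hPmem w)
  have hs := hPproj u ws hws
  set s := u - P u with hsdef
  set t := w - P w with htdef
  have hvp : ‖v - P u‖ ^ 2 = ‖s‖ ^ 2 + 2 * ⟪s, v - u⟫ + ‖v - u‖ ^ 2 := by
    rw [← norm_add_sq_real, hsdef]; congr 2; abel
  have hinner : ⟪s, n • v - (n - 1) • w - ws⟫ = n * ⟪s, v - u⟫ + n * ‖s‖ ^ 2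
      - (n - 1) * ⟪s, t⟫ - (n - 1) * ⟪s, P w - P u⟫ - ⟪s, ws - P u⟫ := by
    have : n • v - (n - 1) • w - ws = n • (v - u) + n • s - (n - 1) • t
        - (n - 1) • (P w - P u) - (ws - P u) := by
      rw [hsdef, htdef]; module
    rw [this]
    simp only [inner_sub_right, inner_add_right, real_inner_smul_right,
      real_inner_self_eq_norm_sq]
  have hsq : 0 ≤ n ^ 2 * ‖s‖ ^ 2 - 2 * (n * (n - 1) * ⟪s, t⟫) + (n - 1) ^ 2 * ‖t‖ ^ 2 := by
    have h1 := norm_sub_sq_real (n • s) ((n - 1) • t)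
    simp only [norm_smul, mul_pow, Real.norm_eq_abs, sq_abs, real_inner_smul_left,
      real_inner_smul_right] at h1
    nlinarith [sq_nonneg ‖n • s - (n - 1) • t‖]
  have hv' := mul_le_mul_of_nonneg_left hv (by positivity : 0 ≤ n ^ 2 / 2)
  have hq' := mul_nonneg (mul_nonneg (by linarith : 0 ≤ n) (sub_nonneg.2 hn)) (neg_nonneg.2 hq)
  have hs' := mul_nonneg (by linarith : 0 ≤ n) (neg_nonneg.2 hs)
  rw [hvp] at hv'
  rw [hinner]
  nlinarith

end Projection

/-- Value and feasibility bounds from a penalized estimate and a multiplier bound. -/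
lemma abs_le_and_le_of_penalized {φ d l ρ R k : ℝ} (hρ : 0 < ρ) (hk : 0 < k)
    (hl : 0 ≤ l) (hup : k * φ + ρ * k ^ 2 / 2 * d ^ 2 ≤ R / 2) (hlow : -(l * d) ≤ φ) :
    |φ| ≤ max (ρ * R) (2 * l * (l + √(l ^ 2 + ρ * R))) / (2 * ρ * k) ∧
      d ≤ (l + √(l ^ 2 + ρ * R)) / (ρ * k) := by
  have hD : ρ * k * d ≤ l + √(l ^ 2 + ρ * R) := by
    have h1 : (ρ * k * d - l) ^ 2 ≤ l ^ 2 + ρ * R := by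
      have h2 := mul_le_mul_of_nonneg_left hlow (mul_pos hρ hk).le
      have h3 := mul_le_mul_of_nonneg_left hup hρ.le
      nlinarith
    have := Real.le_sqrt_of_sq_le h1
    linarith
  have hρk : 0 < ρ * k := mul_pos hρ hk
  have hd' : d ≤ (l + √(l ^ 2 + ρ * R)) / (ρ * k) := by
    rw [le_div_iff₀ hρk]; linarith
  refine ⟨?_, hd'⟩
  rw [le_div_iff₀ (by positivity)]
  rcases abs_cases φ with ⟨ha, -⟩ | ⟨ha, -⟩ <;> rw [ha]
  · refine le_max_of_le_left ?_
    have h0 : 0 ≤ ρ * k ^ 2 / 2 * d ^ 2 := by positivity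
    have h3 := mul_le_mul_of_nonneg_left (by linarith : k * φ ≤ R / 2) hρ.le
    linarith
  · refine le_max_of_le_right ?_
    have h2 := mul_le_mul_of_nonneg_left hlow hρk.le
    have h3 := mul_le_mul_of_nonneg_left hD hl
    linarith

/-- Nesterov extrapolation points as averages of the iterates and an auxiliary sequence. -/
lemma smul_extrapolation {E : Type*} [AddCommGroup E] [Module ℝ E] {z zh : ℕ → E}
    (h0 : zh 0 = z 0)
    (hmom : ∀ k : ℕ, zh (k + 1) = z (k + 1) + ((k : ℝ) / ((k : ℝ) + 2)) • (z (k + 1) - z k))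
    (k : ℕ) :
    ((k : ℝ) + 1) • zh k = (k : ℝ) • z k + ((k : ℝ) • z k - ((k : ℝ) - 1) • z (k - 1)) := by
  cases k with
  | zero => simp [h0]
  | succ k =>
    have hk : ((k : ℝ) + 1 + 1) * ((k : ℝ) / ((k : ℝ) + 2)) = k := by
      have : (k : ℝ) + 2 ≠ 0 := by positivity
      field_simp; ring
    rw [hmom, Nat.add_sub_cancel]
    push_cast
    rw [smul_add, smul_smul, hk]
    module

/-- (Theorem 3, first part: Algorithm 1 variant for the sum of three
objective terms `F(x,y) = f(x) + g(y) + h(y)` with `h` convex and `L_h`-Lipschitz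
gradient.) With `ρ_k = ρ₀(k+1)`, `γ_k = γ₀(k+1)`, `β̂_k = ρ_k‖B‖² + L_h`, and the
updates of the modified Algorithm 1, for every `k ≥ 1`:
`|F(zᵏ) − F⋆| ≤ max{ρ₀R_p², 2‖λ⋆‖R_d}/(2ρ₀k)` and
`dist_K(A xᵏ + B yᵏ − c) ≤ R_d/(ρ₀k)`, where
`R_p² = γ₀‖x⁰−x⋆‖² + (L_h + ρ₀‖B‖²)‖y⁰−y⋆‖²` and
`R_d = ‖λ⋆‖ + √(‖λ⋆‖² + ρ₀R_p²)`. -/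
theorem stmt_19
    {H1 H2 H : Type*}
    [NormedAddCommGroup H1] [InnerProductSpace ℝ H1] [CompleteSpace H1]
    [NormedAddCommGroup H2] [InnerProductSpace ℝ H2] [CompleteSpace H2]
    [NormedAddCommGroup H] [InnerProductSpace ℝ H] [CompleteSpace H]
    (A : H1 →L[ℝ] H) (B : H2 →L[ℝ] H) (c : H) (K : Set H)
    (hKne : K.Nonempty) (hKcl : IsClosed K) (hKcv : Convex ℝ K)
    (P : H → H) (hPmem : ∀ u, P u ∈ K)
    (hPproj : ∀ u, ∀ w ∈ K, ⟪u - P u, w - P u⟫ ≤ 0)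
    (f : H1 → ℝ) (g : H2 → ℝ) (h : H2 → ℝ)
    (hf : ConvexOn ℝ Set.univ f) (hg : ConvexOn ℝ Set.univ g)
    (hh : ConvexOn ℝ Set.univ h)
    (h' : H2 → H2) (hgrad : ∀ y : H2, HasGradientAt h (h' y) y)
    (Lh : ℝ) (hLh : 0 ≤ Lh)
    (hLip : ∀ a b : H2, ‖h' a - h' b‖ ≤ Lh * ‖a - b‖)
    (xs : H1) (ys : H2) (lams : H)
    (hfeas : A xs + B ys - c ∈ K)
    (hsaddle : ∀ (x : H1) (y : H2), ∀ r ∈ K,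
      f x + g y + h y - ⟪lams, A x + B y - r - c⟫ ≥ f xs + g ys + h ys)
    (ρ0 γ0 : ℝ) (hρ0 : 0 < ρ0) (hγ0 : 0 ≤ γ0)
    (x : ℕ → H1) (y : ℕ → H2) (xh : ℕ → H1) (yh : ℕ → H2)
    (hx0 : xh 0 = x 0) (hy0 : yh 0 = y 0)
    (hxsub : ∀ k : ℕ, ∃ ξ : H1,
      (∀ x' : H1, f x' ≥ f (x (k+1)) + ⟪ξ, x' - x (k+1)⟫) ∧
      ξ + (ρ0 * ((k : ℝ) + 1)) • (ContinuousLinearMap.adjoint A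
            ((A (x (k+1)) + B (yh k) - c) - P (A (x (k+1)) + B (yh k) - c)))
        + (γ0 * ((k : ℝ) + 1)) • (x (k+1) - xh k) = 0)
    (hysub : ∀ k : ℕ, ∃ η : H2,
      (∀ y' : H2, g y' ≥ g (y (k+1)) + ⟪η, y' - y (k+1)⟫) ∧
      η + h' (yh k)
        + (ρ0 * ((k : ℝ) + 1)) • (ContinuousLinearMap.adjoint B
            ((A (x (k+1)) + B (yh k) - c) - P (A (x (k+1)) + B (yh k) - c)))
        + (ρ0 * ((k : ℝ) + 1) * ‖B‖ ^ 2 + Lh) • (y (k+1) - yh k) = 0)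
    (hmomx : ∀ k : ℕ, xh (k+1) = x (k+1) + ((k : ℝ)/((k : ℝ) + 2)) • (x (k+1) - x k))
    (hmomy : ∀ k : ℕ, yh (k+1) = y (k+1) + ((k : ℝ)/((k : ℝ) + 2)) • (y (k+1) - y k)) :
    ∀ k : ℕ, 1 ≤ k →
      |(f (x k) + g (y k) + h (y k)) - (f xs + g ys + h ys)| ≤
        max (ρ0 * (γ0 * ‖x 0 - xs‖ ^ 2 + (Lh + ρ0 * ‖B‖ ^ 2) * ‖y 0 - ys‖ ^ 2))
            (2 * ‖lams‖ * (‖lams‖ + Real.sqrt (‖lams‖ ^ 2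
              + ρ0 * (γ0 * ‖x 0 - xs‖ ^ 2 + (Lh + ρ0 * ‖B‖ ^ 2) * ‖y 0 - ys‖ ^ 2))))
          / (2 * ρ0 * k) ∧
      Metric.infDist (A (x k) + B (y k) - c) K ≤
        (‖lams‖ + Real.sqrt (‖lams‖ ^ 2
            + ρ0 * (γ0 * ‖x 0 - xs‖ ^ 2 + (Lh + ρ0 * ‖B‖ ^ 2) * ‖y 0 - ys‖ ^ 2)))
          / (ρ0 * k) := by
  set Rp := γ0 * ‖x 0 - xs‖ ^ 2 + (Lh + ρ0 * ‖B‖ ^ 2) * ‖y 0 - ys‖ ^ 2 with hRp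
  set w : ℕ → H := fun k => A (x k) + B (y k) - c with hw
  have hinv : ∀ k : ℕ,
      k * ((f (x k) + g (y k) + h (y k)) - (f xs + g ys + h ys))
        + ρ0 * k ^ 2 / 2 * ‖w k - P (w k)‖ ^ 2
        + γ0 / 2 * ‖(k : ℝ) • x k - ((k : ℝ) - 1) • x (k - 1) - xs‖ ^ 2
        + (ρ0 * ‖B‖ ^ 2 + Lh / (k + 1)) / 2
          * ‖(k : ℝ) • y k - ((k : ℝ) - 1) • y (k - 1) - ys‖ ^ 2 ≤ Rp / 2 := by
    intro k
    induction k with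
    | zero => simp [hRp]; linarith
    | succ k ih =>
      have hn : (1 : ℝ) ≤ (k : ℝ) + 1 := by linarith [k.cast_nonneg (α := ℝ)]
      have hxt := smul_extrapolation hx0 hmomx k
      have hyt := smul_extrapolation hy0 hmomy k
      obtain ⟨ξ, hξ, hξ0⟩ := hxsub k
      obtain ⟨η, hη, hη0⟩ := hysub k
      have hX := accelerated_prox_step_s19 (G := f) (z := x k) (e := 0) (zs := xs)
        (zt := (k : ℝ) • x k - ((k : ℝ) - 1) • x (k - 1)) A hn
        (fun v => by linarith [hξ v]) hξ0 (by rw [hxt]; simp)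
      have hY := accelerated_prox_step_s19 (G := fun v => g v + h v) (z := y k) (zn := y (k + 1))
        (zh := yh k) (ζ := η + h' (yh k)) (θ := ρ0 * ((k : ℝ) + 1))
        (s := A (x (k + 1)) + B (yh k) - c - P (A (x (k + 1)) + B (yh k) - c))
        (e := Lh / 2 * ‖y (k + 1) - yh k‖ ^ 2) (b := ρ0 * ‖B‖ ^ 2 + Lh / (k + 1)) (zs := ys)
        (zt := (k : ℝ) • y k - ((k : ℝ) - 1) • y (k - 1)) B hn
        (fun v => by
          have h1 := hη v
          have h2 := hh.add_inner_gradient_le hgrad (yh k) v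
          have h3 := le_add_inner_gradient_add_sq hgrad hLip (yh k) (y (k + 1))
          have h4 : ⟪h' (yh k), v - y (k + 1)⟫
              = ⟪h' (yh k), v - yh k⟫ - ⟪h' (yh k), y (k + 1) - yh k⟫ := by
            rw [← inner_sub_right, sub_sub_sub_cancel_right]
          rw [inner_add_left]
          linarith)
        (by
          have : (ρ0 * ‖B‖ ^ 2 + Lh / (k + 1)) * ((k : ℝ) + 1)
              = ρ0 * ((k : ℝ) + 1) * ‖B‖ ^ 2 + Lh := by
            field_simp
          rw [this]; exact hη0)
        (by rw [hyt]; simp)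
      have hK := accelerated_penalty_step hPmem hPproj (A (x (k + 1)) + B (yh k) - c)
        (w (k + 1)) (w k) hfeas hn
      have hvu : ‖w (k + 1) - (A (x (k + 1)) + B (yh k) - c)‖ ^ 2
          ≤ ‖B‖ ^ 2 * ‖y (k + 1) - yh k‖ ^ 2 := by
        have h1 : w (k + 1) - (A (x (k + 1)) + B (yh k) - c) = B (y (k + 1) - yh k) := by
          simp only [map_sub, hw]; abel
        rw [h1, ← mul_pow]
        gcongr
        exact B.le_opNorm _
      have hlin : ((k : ℝ) + 1) • w (k + 1) - ((k : ℝ) + 1 - 1) • w k - (A xs + B ys - c)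
          = A (((k : ℝ) + 1) • x (k + 1) - ((k : ℝ) + 1 - 1) • x k - xs)
            + B (((k : ℝ) + 1) • y (k + 1) - ((k : ℝ) + 1 - 1) • y k - ys) := by
        simp only [map_sub, map_smul, hw]; module
      rw [hlin, inner_add_right] at hK
      have hK' := mul_le_mul_of_nonneg_left
        (hK.trans (add_le_add_right (mul_le_mul_of_nonneg_left hvu
          (by positivity : 0 ≤ ((k : ℝ) + 1) ^ 2 / 2)) _)) hρ0.le
      have hcoef : Lh / ((k : ℝ) + 1 + 1) ≤ Lh / (k + 1) := by
        gcongr; linarith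
      have hdrop := mul_le_mul_of_nonneg_right hcoef
        (sq_nonneg ‖((k : ℝ) + 1) • y (k + 1) - ((k : ℝ) + 1 - 1) • y k - ys‖)
      have hLn : Lh / ((k : ℝ) + 1) * (((k : ℝ) + 1) ^ 2 * ‖y (k + 1) - yh k‖ ^ 2)
          = ((k : ℝ) + 1) * Lh * ‖y (k + 1) - yh k‖ ^ 2 := by
        field_simp
      have hγ : 0 ≤ γ0 * (((k : ℝ) + 1) ^ 2 * ‖x (k + 1) - xh k‖ ^ 2) := by positivity
      push_cast
      simp only [add_sub_cancel_right] at hX hY hK' hdrop ⊢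
      linarith
  intro k hk
  have hkpos : (0 : ℝ) < k := by exact_mod_cast hk
  have hdist : Metric.infDist (w k) K ≤ ‖w k - P (w k)‖ := by
    rw [← dist_eq_norm]; exact Metric.infDist_le_dist_of_mem (hPmem _)
  have hlow : -(‖lams‖ * ‖w k - P (w k)‖)
      ≤ (f (x k) + g (y k) + h (y k)) - (f xs + g ys + h ys) := by
    have h1 := hsaddle (x k) (y k) (P (w k)) (hPmem _)
    have h2 : A (x k) + B (y k) - P (w k) - c = w k - P (w k) :=
      sub_right_comm _ _ _
    rw [h2] at h1
    have h3 := neg_le_of_abs_le (abs_real_inner_le_norm lams (w k - P (w k)))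
    linarith
  have hup : k * ((f (x k) + g (y k) + h (y k)) - (f xs + g ys + h ys))
      + ρ0 * (k : ℝ) ^ 2 / 2 * ‖w k - P (w k)‖ ^ 2 ≤ Rp / 2 := by
    have h1 : 0 ≤ γ0 / 2 * ‖(k : ℝ) • x k - ((k : ℝ) - 1) • x (k - 1) - xs‖ ^ 2 := by
      positivity
    have h2 : 0 ≤ (ρ0 * ‖B‖ ^ 2 + Lh / (k + 1)) / 2
        * ‖(k : ℝ) • y k - ((k : ℝ) - 1) • y (k - 1) - ys‖ ^ 2 := by
      positivity
    linarith [hinv k]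
  have hfinal := abs_le_and_le_of_penalized hρ0 hkpos (norm_nonneg lams) hup hlow
  exact ⟨hfinal.1, hdist.trans hfinal.2⟩
end
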